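/- Let (W,S) be a finite Coxeter system with longest element w₀ and c a Coxeter element. An element w ∈ W is a c-singleton (i.e., w is c-sortable and ww₀ is c⁻¹-sortable) if and only if w is a prefix, up to commutations, of the c-sorting word of w₀. -/

import Mathlib

noncomputable section

namespace CambrianPaper

open CoxeterSystem

variable {B : Type*} {W : Type*} [Group W] {M : CoxeterMatrix B}

/-- One greedy pass of the letters of `c` over `u`: returns the taken letters (in order) and
the new remainder.  A letter `q` is taken if it is a left descent of the current remainder. -/
def pass (cs : CoxeterSystem M W) (c : List B) (u : W) : List B × W :=
  c.foldl (fun p q =>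
    if cs.length (cs.simple q * p.2) < cs.length p.2 then (p.1 ++ [q], cs.simple q * p.2)
    else p) ([], u)

/-- The remainder of `w` after `n` greedy passes of `c`. -/
def remainder (cs : CoxeterSystem M W) (c : List B) (w : W) : ℕ → W
  | 0 => w
  | n + 1 => (pass cs c (remainder cs c w n)).2

/-- The `n`-th factor (`n = 0, 1, 2, …`) of the `c`-factorization of `w`:
the letters of `c` taken in the `n`-th greedy pass.  (All but finitely many factors are
empty; the nonempty ones are the `c_{(K_i)}` of the `c`-factorization of `w`.) -/
def factor (cs : CoxeterSystem M W) (c : List B) (w : W) (n : ℕ) : List B :=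
  (pass cs c (remainder cs c w n)).1

/-- The `c`-sorting word of `w` : the concatenation of the factors of the
`c`-factorization of `w` (the lexicographically first reduced subword of `c^∞` for `w`);
`cs.length w` passes always suffice. -/
def sortingWord (cs : CoxeterSystem M W) (c : List B) (w : W) : List B :=
  ((List.range (cs.length w)).map (factor cs c w)).flatten

/-- `w` is `c`-sortable : the factors of its `c`-factorization are nested. -/
def IsSortable (cs : CoxeterSystem M W) (c : List B) (w : W) : Prop :=
  ∀ n : ℕ, ∀ q ∈ factor cs c w (n + 1), q ∈ factor cs c w n

/-- `w` is a `c`-singleton : `w` is `c`-sortable and `w w₀` is `c⁻¹`-sortable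
(the reduced word `c.reverse` represents the inverse of the Coxeter element). -/
def IsCSingleton (cs : CoxeterSystem M W) (c : List B) (w₀ w : W) : Prop :=
  IsSortable cs c w ∧ IsSortable cs c.reverse (w * w₀)

/-- The right weak order on `W`. -/
def weakLE (cs : CoxeterSystem M W) (u v : W) : Prop :=
  cs.length v = cs.length u + cs.length (u⁻¹ * v)

/-- A single commutation move on words: interchange two adjacent commuting letters. -/
def CommMove (M : CoxeterMatrix B) (l l' : List B) : Prop :=
  ∃ l₁ l₂ : List B, ∃ a b : B, M a b = 2 ∧ l = l₁ ++ a :: b :: l₂ ∧ l' = l₁ ++ b :: a :: l₂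

/-- Equivalence of words up to commutations. -/
def CommEquiv (M : CoxeterMatrix B) : List B → List B → Prop :=
  Relation.ReflTransGen (CommMove M)

/-- `u ∈ W` is a prefix of the word `v` up to commutations. -/
def IsPrefixUpToComm (cs : CoxeterSystem M W) (v : List B) (u : W) : Prop :=
  ∃ v' u' : List B, CommEquiv M v v' ∧ u' <+: v' ∧ cs.wordProd u' = u

section Geometric

variable [Fintype B] [DecidableEq B]

/-- Minus the Gram matrix of the canonical bilinear form. -/
def gram (M : CoxeterMatrix B) (i j : B) : ℝ := Real.cos (Real.pi / M i j)

/-- Pairing with the `i`-th simple root under the canonical bilinear form. -/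
def pairing (M : CoxeterMatrix B) (i : B) : (B → ℝ) →ₗ[ℝ] ℝ :=
  -∑ j, gram M i j • LinearMap.proj j

/-- The simple root indexed by `i`. -/
def simpleRoot (i : B) : B → ℝ := Pi.single i 1

omit [Fintype B] [DecidableEq B] in
lemma gram_self (i : B) : gram M i i = -1 := by
  simp [gram]

omit [Fintype B] [DecidableEq B] in
lemma gram_symm (i j : B) : gram M i j = gram M j i := by
  simp [gram, M.symmetric i j]

omit [Fintype B] [DecidableEq B] in
lemma gram_nonneg {i j : B} (h : i ≠ j) : 0 ≤ gram M i j := by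
  have h1 := M.off_diagonal i j h
  rcases Nat.eq_zero_or_pos (M i j) with h0 | h0
  · simp [gram, h0]
  · have h2 : (2 : ℝ) ≤ M i j := by exact_mod_cast (by omega : 2 ≤ M i j)
    have h3 : Real.pi / M i j ≤ Real.pi / 2 := by gcongr
    apply Real.cos_nonneg_of_neg_pi_div_two_le_of_le _ h3
    have : 0 ≤ Real.pi / M i j := by positivity
    linarith [Real.pi_pos]

omit [Fintype B] [DecidableEq B] in
lemma gram_eq_zero {i j : B} (h : i ≠ j) (h0 : gram M i j = 0) : M i j = 2 := by
  have h1 := M.off_diagonal i j h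
  by_contra h2
  rcases Nat.eq_zero_or_pos (M i j) with h3 | h3
  · simp [gram, h3] at h0
  · have h2 : (2 : ℝ) < M i j := by exact_mod_cast (by omega : 2 < M i j)
    have h3 : Real.pi / M i j < Real.pi / 2 := by
      gcongr
    have : 0 < Real.cos (Real.pi / M i j) := by
      apply Real.cos_pos_of_mem_Ioo
      have : 0 ≤ Real.pi / M i j := by positivity
      constructor <;> linarith [Real.pi_pos]
    simp only [gram] at h0
    linarith

omit [DecidableEq B] in
lemma pairing_apply (i : B) (x : B → ℝ) : pairing M i x = -∑ j, gram M i j * x j := by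
  simp [pairing]

lemma pairing_simpleRoot (i j : B) : pairing M i (simpleRoot j) = -gram M i j := by
  simp [pairing_apply, simpleRoot, Pi.single_apply]

lemma two_pairing_simpleRoot (i : B) : ((2 : ℝ) • pairing M i) (simpleRoot i) = 2 := by
  simp [pairing_simpleRoot, gram_self]

/-- The reflection of the geometric representation attached to a simple generator. -/
def geomRefl (M : CoxeterMatrix B) (i : B) : (B → ℝ) ≃ₗ[ℝ] (B → ℝ) :=
  Module.reflection (two_pairing_simpleRoot (M := M) i)

lemma geomRefl_apply (i : B) (x : B → ℝ) :
    geomRefl M i x = x - (2 * pairing M i x) • simpleRoot i := by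
  simp [geomRefl, Module.reflection_apply]

lemma geomRefl_mul_self (i : B) : geomRefl M i * geomRefl M i = 1 := by
  ext x : 1
  exact Module.involutive_reflection _ x

open Polynomial in
lemma geomRefl_isLiftable : M.IsLiftable (geomRefl M) := by
  intro i j
  rcases eq_or_ne i j with rfl | hij
  · simp [geomRefl_mul_self]
  have h1 := M.off_diagonal i j hij
  rcases Nat.eq_zero_or_pos (M i j) with h0 | h0
  · simp [h0]
  have hm2 : 2 ≤ M i j := by omega
  set m := M i j with hm
  ext z : 1
  have key := Module.reflection_mul_reflection_pow_apply (two_pairing_simpleRoot (M := M) i)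
    (two_pairing_simpleRoot (M := M) j) m z _ rfl
  change ((Module.reflection (two_pairing_simpleRoot (M := M) i) *
    Module.reflection (two_pairing_simpleRoot (M := M) j)) ^ m) z = z
  rw [key]
  set θ : ℝ := Real.pi / m with hθ
  have hm0 : (m : ℝ) ≠ 0 := by positivity
  have ht : ((2 : ℝ) • pairing M i) (simpleRoot j) * ((2 : ℝ) • pairing M j) (simpleRoot i) - 2
      = 2 * Real.cos (2 * θ) := by
    simp only [LinearMap.smul_apply, pairing_simpleRoot, smul_eq_mul, gram_symm (M := M) j i]
    rw [Real.cos_two_mul]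
    simp only [gram, ← hm, ← hθ]; ring
  rw [ht]
  rcases hm2.eq_or_lt with h2 | h3
  · have hg : gram M i j = 0 := by
      simp [gram, ← hm, ← h2]
    have hθ2 : 2 * θ = Real.pi := by rw [hθ, ← h2]; push_cast; ring
    rw [← h2, hθ2]
    simp [pairing_simpleRoot, gram_symm (M := M) j i, hg]
    module
  have hs : Real.sin (2 * θ) ≠ 0 := by
    have h3 : (3 : ℝ) ≤ m := by exact_mod_cast h3
    have hpos := Real.pi_pos
    refine (Real.sin_pos_of_pos_of_lt_pi (by positivity) ?_).ne'
    rw [hθ, ← mul_div_assoc, div_lt_iff₀ (by positivity)]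
    nlinarith
  have hmθ : (m : ℝ) * θ = Real.pi := by rw [hθ]; field_simp
  have hS (n : ℤ) : (Chebyshev.S ℝ n).eval (2 * Real.cos (2 * θ)) =
      Real.sin ((n + 1) * (2 * θ)) / Real.sin (2 * θ) := by
    rw [eq_div_iff hs, Chebyshev.S_two_mul_real_cos]
  rcases Nat.even_or_odd' m with ⟨k, hk | hk⟩
  · have e1 : ((m : ℤ) - 2) / 2 = k - 1 := by omega
    have e2 : ((m : ℤ) - 1) / 2 = k - 1 := by omega
    have h0 : (Chebyshev.S ℝ (k - 1)).eval (2 * Real.cos (2 * θ)) = 0 := by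
      rw [hS]
      have : ((k - 1 : ℤ) + 1 : ℝ) * (2 * θ) = Real.pi := by
        rw [← hmθ, hk]; push_cast; ring
      rw [this]; simp
    rw [e1, e2, h0]; simp
  · have e1 : ((m : ℤ) - 2) / 2 = k - 1 := by omega
    have e2 : ((m : ℤ) - 1) / 2 = k := by omega
    have e3 : ((m : ℤ) - 3) / 2 = k - 1 := by omega
    have e4 : (m : ℤ) / 2 = k := by omega
    have h0 : (Chebyshev.S ℝ k).eval (2 * Real.cos (2 * θ)) +
        (Chebyshev.S ℝ (k - 1)).eval (2 * Real.cos (2 * θ)) = 0 := by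
      rw [hS, hS, ← add_div]
      have h1 : ((k : ℤ) + 1 : ℝ) * (2 * θ) = Real.pi + θ := by
        rw [← hmθ, hk]; push_cast; ring
      have h2 : ((k - 1 : ℤ) + 1 : ℝ) * (2 * θ) = Real.pi - θ := by
        rw [← hmθ, hk]; push_cast; ring
      rw [h1, h2, Real.sin_pi_sub, add_comm Real.pi, Real.sin_add_pi]; simp
    rw [e1, e2, e3, e4, h0]; simp

/-- The geometric representation. -/
def geomRep (cs : CoxeterSystem M W) : W →* ((B → ℝ) ≃ₗ[ℝ] (B → ℝ)) :=
  cs.lift ⟨geomRefl M, geomRefl_isLiftable⟩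

@[simp] lemma geomRep_simple (cs : CoxeterSystem M W) (i : B) :
    geomRep cs (cs.simple i) = geomRefl M i :=
  cs.lift_apply_simple _ i

end Geometric

section Geometric
variable [Fintype B] [DecidableEq B]

/-- The Chebyshev-type coefficients describing the roots of a dihedral subsystem. -/
def dihedralCoeff (t : ℝ) : ℕ → ℝ
  | 0 => 0
  | 1 => 1
  | k + 2 => t * dihedralCoeff t (k + 1) - dihedralCoeff t k

lemma dihedralCoeff_two_mul_cos (θ : ℝ) : ∀ k : ℕ,
    dihedralCoeff (2 * Real.cos θ) k * Real.sin θ = Real.sin (k * θ)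
  | 0 => by simp [dihedralCoeff]
  | 1 => by simp [dihedralCoeff]
  | k + 2 => by
    have h1 := dihedralCoeff_two_mul_cos θ (k + 1)
    have h2 := dihedralCoeff_two_mul_cos θ k
    have e1 : ((k + 2 : ℕ) : ℝ) * θ = ((k + 1 : ℕ) : ℝ) * θ + θ := by push_cast; ring
    have e2 : (k : ℝ) * θ = ((k + 1 : ℕ) : ℝ) * θ - θ := by push_cast; ring
    rw [e2, Real.sin_sub] at h2
    rw [e1, Real.sin_add, dihedralCoeff]
    linear_combination 2 * Real.cos θ * h1 - h2

lemma dihedralCoeff_two : ∀ k : ℕ, dihedralCoeff 2 k = k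
  | 0 => by simp [dihedralCoeff]
  | 1 => by simp [dihedralCoeff]
  | k + 2 => by
    rw [dihedralCoeff, dihedralCoeff_two (k + 1), dihedralCoeff_two k]; push_cast; ring

omit [Fintype B] [DecidableEq B] in
lemma dihedralCoeff_nonneg {i j : B} (hij : i ≠ j) {k : ℕ} (hk : M i j = 0 ∨ k ≤ M i j) :
    0 ≤ dihedralCoeff (2 * gram M i j) k := by
  rcases Nat.eq_zero_or_pos (M i j) with h0 | h0
  · simp [gram, h0, dihedralCoeff_two]
  have hk : k ≤ M i j := by omega
  have h2 : (2 : ℝ) ≤ M i j := by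
    have := M.off_diagonal i j hij
    exact_mod_cast (by omega : 2 ≤ M i j)
  have hpos := Real.pi_pos
  have hs : 0 < Real.sin (Real.pi / M i j) := by
    refine Real.sin_pos_of_pos_of_lt_pi (by positivity) ?_
    rw [div_lt_iff₀ (by positivity)]
    nlinarith
  have h := dihedralCoeff_two_mul_cos (Real.pi / M i j) k
  have h4 : 0 ≤ Real.sin (k * (Real.pi / M i j)) := by
    refine Real.sin_nonneg_of_nonneg_of_le_pi (by positivity) ?_
    rw [← mul_div_assoc, div_le_iff₀ (by positivity)]
    have : (k : ℝ) ≤ M i j := by exact_mod_cast hk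
    nlinarith
  rw [← h] at h4
  exact nonneg_of_mul_nonneg_left h4 hs

lemma geomRefl_simpleRoot (i j : B) :
    geomRefl M i (simpleRoot j) = simpleRoot j + (2 * gram M i j) • simpleRoot i := by
  rw [geomRefl_apply, pairing_simpleRoot]; module

lemma geomRefl_simpleRoot_self (i : B) :
    geomRefl M i (simpleRoot i) = -simpleRoot i := by
  rw [geomRefl_simpleRoot, gram_self]; module

variable (cs : CoxeterSystem M W)

lemma geomRep_mul_apply (u v : W) (x : B → ℝ) :
    geomRep cs (u * v) x = geomRep cs u (geomRep cs v x) := by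
  simp

lemma geomRep_nonneg_of_dihedral_step {n N : ℕ} {s t : B} (hst : s ≠ t)
    (ih : ∀ v : W, ∀ r : B, cs.length v < n → ¬cs.IsRightDescent v r →
      0 ≤ geomRep cs v (simpleRoot r)) {v : W} {k : ℕ} (hv : cs.length v = N) (hn : N < n)
    (hl : cs.length (v * cs.wordProd (alternatingWord t s (k + 1))) = N + k + 1)
    (ho : ¬cs.IsRightDescent v (if Even k then t else s)) :
    0 ≤ geomRep cs v (dihedralCoeff (2 * gram M s t) (k + 1) •
        simpleRoot (if Even k then s else t) +
      dihedralCoeff (2 * gram M s t) k • simpleRoot (if Even k then t else s)) := by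
  have hp : ¬cs.IsRightDescent v (if Even k then s else t) := by
    intro hp
    rw [cs.isRightDescent_iff] at hp
    rw [alternatingWord_succ', wordProd_cons, ← mul_assoc] at hl
    have h1 := cs.length_mul_le (v * cs.simple (if Even k then s else t))
      (cs.wordProd (alternatingWord t s k))
    have h2 := cs.length_wordProd_le (alternatingWord t s k)
    rw [length_alternatingWord] at h2
    omega
  have hm : M s t = 0 ∨ k + 1 ≤ M s t := by
    by_contra hcon
    push Not at hcon
    have h3 : ¬cs.IsReduced (alternatingWord t s (k + 1)) := by
      apply cs.not_isReduced_alternatingWord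
      · rw [M.symmetric]; exact hcon.1
      · rw [M.symmetric]; exact hcon.2
    apply h3
    have h1 := cs.length_mul_le v (cs.wordProd (alternatingWord t s (k + 1)))
    have h2 := cs.length_wordProd_le (alternatingWord t s (k + 1))
    rw [CoxeterSystem.IsReduced]
    rw [length_alternatingWord] at h2 ⊢
    omega
  rw [map_add, map_smul, map_smul]
  exact add_nonneg (smul_nonneg (dihedralCoeff_nonneg hst hm) (ih v _ (hv ▸ hn) hp))
    (smul_nonneg (dihedralCoeff_nonneg hst (by omega)) (ih v _ (hv ▸ hn) ho))

lemma geomRep_nonneg_of_dihedral {n : ℕ} {s t : B} (hst : s ≠ t)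
    (ih : ∀ v : W, ∀ r : B, cs.length v < n → ¬cs.IsRightDescent v r →
      0 ≤ geomRep cs v (simpleRoot r)) (N : ℕ) :
    ∀ (v : W) (k : ℕ), cs.length v = N → N < n →
      cs.length (v * cs.wordProd (alternatingWord t s (k + 1))) = N + k + 1 →
      0 ≤ geomRep cs v (dihedralCoeff (2 * gram M s t) (k + 1) •
          simpleRoot (if Even k then s else t) +
        dihedralCoeff (2 * gram M s t) k • simpleRoot (if Even k then t else s)) := by
  induction N with
  | zero =>
    intro v k hv hn hl
    exact geomRep_nonneg_of_dihedral_step cs hst ih hv hn hl (by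
      rw [cs.isRightDescent_iff]; omega)
  | succ N IH =>
    intro v k hv hn hl
    by_cases ho : cs.IsRightDescent v (if Even k then t else s)
    · have h1 := cs.isRightDescent_iff.1 ho
      set o := if Even k then t else s with ho'
      have hv' : v = v * cs.simple o * cs.simple o := by simp
      have := IH (v * cs.simple o) (k + 1) (by omega) (by omega) (by
        rw [alternatingWord_succ' t s (k + 1), wordProd_cons, ← mul_assoc]
        have : (if Even (k + 1) then s else t) = o := by
          rw [ho']; simp only [Nat.even_add_one]; split_ifs <;> rfl
        rw [this, ← hv', hl]; ring)
      rw [hv', geomRep_mul_apply, geomRep_simple, map_add, map_smul, map_smul,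
        geomRefl_simpleRoot_self, geomRefl_simpleRoot]
      convert this using 2
      have e1 : (if Even (k + 1) then s else t) = o := by
        rw [ho']; simp only [Nat.even_add_one]; split_ifs <;> rfl
      have e2 : (if Even (k + 1) then t else s) = if Even k then s else t := by
        simp only [Nat.even_add_one]; split_ifs <;> rfl
      have e3 : gram M o (if Even k then s else t) = gram M s t := by
        rw [ho']; split_ifs
        · exact gram_symm _ _
        · rfl
      rw [e1, e2, e3, dihedralCoeff]
      module
    · exact geomRep_nonneg_of_dihedral_step cs hst ih hv hn hl ho

lemma geomRep_simpleRoot_nonneg {w : W} {s : B} (h : ¬cs.IsRightDescent w s) :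
    0 ≤ geomRep cs w (simpleRoot s) := by
  induction hn : cs.length w using Nat.strong_induction_on generalizing w s with
  | _ n IH =>
    subst hn
    by_cases hw : w = 1
    · subst hw
      simp [simpleRoot]
    obtain ⟨t, ht⟩ := cs.exists_rightDescent_of_ne_one hw
    have hst : s ≠ t := by rintro rfl; exact h ht
    have hlen := cs.isRightDescent_iff.1 ht
    have hw' : w = w * cs.simple t * cs.simple t := by simp
    have := geomRep_nonneg_of_dihedral cs hst (n := cs.length w)
      (fun v r hv hr => IH _ hv hr rfl) (cs.length (w * cs.simple t)) (w * cs.simple t) 1 rfl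
      (by omega) (by
        rw [cs.not_isRightDescent_iff] at h
        have : w * cs.simple t * cs.wordProd (alternatingWord t s (1 + 1)) = w * cs.simple s := by
          simp [alternatingWord, wordProd_cons, ← mul_assoc]
        rw [this]; omega)
    rw [hw', geomRep_mul_apply, geomRep_simple, geomRefl_simpleRoot]
    simpa [dihedralCoeff, add_comm, gram_symm (M := M) t s] using this
end Geometric

section Geometric
variable [Fintype B] [DecidableEq B]

variable (cs : CoxeterSystem M W)

omit [Fintype B] in
lemma simpleRoot_nonneg (i : B) : 0 ≤ simpleRoot i := by
  simp [simpleRoot]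

omit [Fintype B] in
lemma simpleRoot_ne_zero (i : B) : simpleRoot i ≠ 0 := by
  simp [simpleRoot]

lemma geomRep_simpleRoot_nonpos {w : W} {s : B} (h : cs.IsRightDescent w s) :
    geomRep cs w (simpleRoot s) ≤ 0 := by
  have h1 := cs.isRightDescent_iff_not_isRightDescent_mul.1 h
  have h2 := geomRep_simpleRoot_nonneg cs h1
  rw [geomRep_mul_apply, geomRep_simple, geomRefl_simpleRoot_self, map_neg] at h2
  simpa using h2

/-- The roots of the geometric representation. -/
def IsRoot (γ : B → ℝ) : Prop := ∃ (w : W) (r : B), γ = geomRep cs w (simpleRoot r)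

variable {cs}

lemma isRoot_simpleRoot (i : B) : IsRoot cs (simpleRoot i) := ⟨1, i, by simp⟩

lemma IsRoot.map {γ : B → ℝ} (h : IsRoot cs γ) (u : W) : IsRoot cs (geomRep cs u γ) := by
  obtain ⟨w, r, rfl⟩ := h
  exact ⟨u * w, r, by simp⟩

lemma IsRoot.neg {γ : B → ℝ} (h : IsRoot cs γ) : IsRoot cs (-γ) := by
  obtain ⟨w, r, rfl⟩ := h
  exact ⟨w * cs.simple r, r, by
    rw [geomRep_mul_apply, geomRep_simple, geomRefl_simpleRoot_self, map_neg]⟩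

lemma IsRoot.nonneg_or_nonpos {γ : B → ℝ} (h : IsRoot cs γ) : 0 ≤ γ ∨ γ ≤ 0 := by
  obtain ⟨w, r, rfl⟩ := h
  by_cases h : cs.IsRightDescent w r
  · exact .inr (geomRep_simpleRoot_nonpos cs h)
  · exact .inl (geomRep_simpleRoot_nonneg cs h)

lemma IsRoot.ne_zero {γ : B → ℝ} (h : IsRoot cs γ) : γ ≠ 0 := by
  obtain ⟨w, r, rfl⟩ := h
  simpa using simpleRoot_ne_zero r

lemma IsRoot.nonneg_of_pos {γ : B → ℝ} (h : IsRoot cs γ) {i : B} (hi : 0 < γ i) : 0 ≤ γ := by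
  refine h.nonneg_or_nonpos.resolve_right fun h' => ?_
  exact absurd (h' i) (not_le.2 hi)

lemma isRightDescent_iff_root {w : W} {s : B} :
    cs.IsRightDescent w s ↔ geomRep cs w (simpleRoot s) ≤ 0 := by
  refine ⟨geomRep_simpleRoot_nonpos cs, fun h => ?_⟩
  by_contra h'
  exact ((isRoot_simpleRoot s).map w).ne_zero (le_antisymm h (geomRep_simpleRoot_nonneg cs h'))

lemma not_isRightDescent_iff_root {w : W} {s : B} :
    ¬cs.IsRightDescent w s ↔ 0 ≤ geomRep cs w (simpleRoot s) := by
  refine ⟨geomRep_simpleRoot_nonneg cs, fun h h' => ?_⟩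
  exact ((isRoot_simpleRoot s).map w).ne_zero (le_antisymm (geomRep_simpleRoot_nonpos cs h') h)

lemma isLeftDescent_iff_root {w : W} {s : B} :
    cs.IsLeftDescent w s ↔ geomRep cs w⁻¹ (simpleRoot s) ≤ 0 := by
  rw [← isRightDescent_iff_root, cs.isRightDescent_inv_iff]

lemma not_isLeftDescent_iff_root {w : W} {s : B} :
    ¬cs.IsLeftDescent w s ↔ 0 ≤ geomRep cs w⁻¹ (simpleRoot s) := by
  rw [← not_isRightDescent_iff_root, cs.isRightDescent_inv_iff]

lemma geomRep_injective : Function.Injective (geomRep cs) := by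
  rw [injective_iff_map_eq_one]
  intro w hw
  by_contra h
  obtain ⟨t, ht⟩ := cs.exists_rightDescent_of_ne_one h
  revert ht
  rw [imp_false, not_isRightDescent_iff_root, hw]
  exact simpleRoot_nonneg t

variable (M) in
/-- The canonical bilinear form. -/
def bform (x y : B → ℝ) : ℝ := ∑ i, x i * pairing M i y

lemma bform_simpleRoot (i : B) (y : B → ℝ) : bform M (simpleRoot i) y = pairing M i y := by
  simp [bform, simpleRoot, Pi.single_apply]

omit [DecidableEq B] in
lemma bform_symm (x y : B → ℝ) : bform M x y = bform M y x := by
  simp only [bform, pairing_apply, mul_neg, Finset.mul_sum, Finset.sum_neg_distrib]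
  rw [Finset.sum_comm]
  congr 1
  refine Finset.sum_congr rfl fun i _ => Finset.sum_congr rfl fun j _ => ?_
  rw [gram_symm]; ring

omit [DecidableEq B] in
lemma bform_sub_smul_left (a : ℝ) (x y z : B → ℝ) :
    bform M (x - a • y) z = bform M x z - a * bform M y z := by
  simp only [bform, Finset.mul_sum, ← Finset.sum_sub_distrib]
  exact Finset.sum_congr rfl fun i _ => by simp; ring

lemma bform_geomRefl (i : B) (x y : B → ℝ) :
    bform M (geomRefl M i x) (geomRefl M i y) = bform M x y := by
  rw [geomRefl_apply, geomRefl_apply, bform_sub_smul_left, bform_symm, bform_sub_smul_left,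
    bform_simpleRoot, bform_simpleRoot, map_sub, map_smul,
    pairing_simpleRoot, gram_self, bform_symm y x, smul_eq_mul]
  ring

lemma bform_geomRep (w : W) (x y : B → ℝ) :
    bform M (geomRep cs w x) (geomRep cs w y) = bform M x y := by
  induction w using cs.simple_induction_left with
  | one => simp
  | mul_simple_left w i ih => rw [geomRep_mul_apply, geomRep_mul_apply, geomRep_simple,
      bform_geomRefl, ih]

lemma IsRoot.bform_self {γ : B → ℝ} (h : IsRoot cs γ) : bform M γ γ = 1 := by
  obtain ⟨w, r, rfl⟩ := h
  rw [bform_geomRep, bform_simpleRoot, pairing_simpleRoot, gram_self]; simp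

lemma geomRefl_apply_of_ne {i j : B} (h : j ≠ i) (x : B → ℝ) : geomRefl M i x j = x j := by
  simp [geomRefl_apply, simpleRoot, h]

lemma geomRefl_apply_self (i : B) (x : B → ℝ) :
    geomRefl M i x i = x i - 2 * pairing M i x := by
  simp [geomRefl_apply, simpleRoot]

lemma IsRoot.geomRefl_nonneg {γ : B → ℝ} (h : IsRoot cs γ) (h0 : 0 ≤ γ) {s : B}
    (hs : γ ≠ simpleRoot s) : 0 ≤ geomRefl M s γ := by
  by_cases hj : ∃ j, j ≠ s ∧ γ j ≠ 0
  · obtain ⟨j, hj, hγ⟩ := hj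
    have h1 := h.map (cs.simple s)
    rw [geomRep_simple] at h1
    refine h1.nonneg_of_pos (i := j) ?_
    rw [geomRefl_apply_of_ne hj]
    exact lt_of_le_of_ne (h0 j) hγ.symm
  · push Not at hj
    exfalso
    apply hs
    have e : γ = (γ s) • simpleRoot s := by
      ext j
      by_cases hjs : j = s
      · subst hjs; simp [simpleRoot]
      · simp [simpleRoot, hjs, hj j hjs]
    have h1 := h.bform_self
    have h2 : bform M γ γ = γ s * γ s := by
      conv_lhs => rw [e]
      have := bform_sub_smul_left (M := M) (-(γ s)) 0 (simpleRoot s) (γ s • simpleRoot s)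
      rw [zero_sub, neg_smul, neg_neg] at this
      rw [this, bform_simpleRoot, map_smul, pairing_simpleRoot, gram_self]
      simp [bform]
    have h3 : γ s = 1 := by
      have := h0 s
      simp only [Pi.zero_apply] at this
      nlinarith
    rw [e, h3, one_smul]

lemma eq_simpleRoot_of_geomRefl_nonpos {γ : B → ℝ} (h : IsRoot cs γ) (h0 : 0 ≤ γ) {s : B}
    (hs : geomRefl M s γ ≤ 0) : γ = simpleRoot s := by
  by_contra hne
  have h1 := h.map (cs.simple s)
  rw [geomRep_simple] at h1
  exact h1.ne_zero (le_antisymm hs (h.geomRefl_nonneg h0 hne))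

lemma conj_eq_of_geomRep_eq {w : W} {s b : B}
    (h : geomRep cs w (simpleRoot s) = simpleRoot b ∨
      geomRep cs w (simpleRoot s) = -simpleRoot b) :
    w * cs.simple s = cs.simple b * w := by
  apply geomRep_injective (cs := cs)
  ext x : 1
  rw [geomRep_mul_apply, geomRep_mul_apply, geomRep_simple, geomRep_simple, geomRefl_apply,
    geomRefl_apply, map_sub, map_smul, ← bform_simpleRoot, ← bform_simpleRoot,
    ← bform_geomRep (cs := cs) w]
  rcases h with h | h
  · rw [h]
  · rw [h]
    have := bform_sub_smul_left (M := M) 1 0 (simpleRoot b) (geomRep cs w x)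
    rw [zero_sub, one_smul] at this
    rw [this]
    simp [bform]

/-- A form of the lifting property. -/
lemma simple_mul_eq_mul_simple {u : W} {r b : B} (h : cs.IsLeftDescent u r)
    (h' : ¬cs.IsLeftDescent (u * cs.simple b) r) :
    cs.simple r * u = u * cs.simple b := by
  rw [isLeftDescent_iff_root] at h
  rw [not_isLeftDescent_iff_root, mul_inv_rev, cs.inv_simple, geomRep_mul_apply,
    geomRep_simple] at h'
  have h1 := ((isRoot_simpleRoot (cs := cs) r).map u⁻¹).neg
  have h2 := eq_simpleRoot_of_geomRefl_nonpos h1 (by simpa using h) (s := b) (by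
    rw [map_neg]; simpa using h')
  have h3 := conj_eq_of_geomRep_eq (cs := cs) (w := u⁻¹) (s := r) (b := b)
    (.inr (by rw [← h2, neg_neg]))
  rw [inv_mul_eq_iff_eq_mul] at h3
  rw [h3]; group

lemma geomRep_wordProd_apply_of_notMem {L : List B} {s : B} (h : s ∉ L) (x : B → ℝ) :
    geomRep cs (cs.wordProd L) x s = x s := by
  induction L with
  | nil => simp
  | cons a L ih =>
    rw [List.mem_cons, not_or] at h
    rw [wordProd_cons, geomRep_mul_apply, geomRep_simple, geomRefl_apply_of_ne h.1, ih h.2]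

lemma geomRep_wordProd_inv_apply_of_notMem {L : List B} {s : B} (h : s ∉ L) (x : B → ℝ) :
    geomRep cs (cs.wordProd L)⁻¹ x s = x s := by
  rw [← wordProd_reverse]
  exact geomRep_wordProd_apply_of_notMem (by simpa using h) x

lemma not_isLeftDescent_wordProd_of_notMem {L : List B} {s : B} (h : s ∉ L) :
    ¬cs.IsLeftDescent (cs.wordProd L) s := by
  rw [isLeftDescent_iff_root]
  intro h'
  have := h' s
  rw [geomRep_wordProd_inv_apply_of_notMem h] at this
  simp [simpleRoot] at this
  linarith

lemma letters_commute_of_fixes {l : List B} {r : B} (hl : cs.IsReduced l) (hr : r ∉ l)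
    (h : geomRep cs (cs.wordProd l)⁻¹ (simpleRoot r) = simpleRoot r) :
    ∀ a ∈ l, M r a = 2 := by
  induction l with
  | nil => simp
  | cons a l ih =>
    rw [List.mem_cons, not_or] at hr
    have hl' : cs.IsReduced l := by simpa using hl.drop 1
    have ha : ¬cs.IsLeftDescent (cs.wordProd l) a := by
      rw [cs.not_isLeftDescent_iff, ← wordProd_cons]
      rw [hl, hl', List.length_cons]
    rw [not_isLeftDescent_iff_root] at ha
    have hr0 : 0 ≤ geomRep cs (cs.wordProd l)⁻¹ (simpleRoot r) :=
      not_isLeftDescent_iff_root.1 (not_isLeftDescent_wordProd_of_notMem hr.2)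
    rw [wordProd_cons, mul_inv_rev, cs.inv_simple, geomRep_mul_apply, geomRep_simple,
      geomRefl_simpleRoot, map_add, map_smul] at h
    have h1 := geomRep_wordProd_inv_apply_of_notMem (cs := cs) hr.2 (simpleRoot r)
    have hg : gram M a r = 0 := by
      by_contra hg
      have hg : 0 < 2 * gram M a r :=
        mul_pos two_pos (lt_of_le_of_ne (gram_nonneg (Ne.symm hr.1)) (Ne.symm hg))
      refine ((isRoot_simpleRoot (cs := cs) a).map (cs.wordProd l)⁻¹).ne_zero ?_
      ext j
      have h2 := congrFun h j
      have h3 := ha j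
      have h4 := hr0 j
      simp only [Pi.add_apply, Pi.smul_apply, smul_eq_mul, Pi.zero_apply] at h2 h3 h4 ⊢
      have h5 : 2 * gram M a r * geomRep cs (cs.wordProd l)⁻¹ (simpleRoot a) j ≤ 0 := by
        by_cases hj : j = r
        · subst hj; linarith
        · have : simpleRoot r j = 0 := by simp [simpleRoot, hj]
          linarith
      nlinarith
    rw [hg] at h
    intro x hx
    rcases List.mem_cons.1 hx with rfl | hx
    · rw [M.symmetric]; exact gram_eq_zero (Ne.symm hr.1) hg
    · exact ih hl' hr.2 (by simpa using h) x hx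

/-- If left multiplication by `r` agrees with right multiplication by a simple reflection on a
reduced word that avoids `r`, then `r` commutes with every letter of the word. -/
lemma commute_of_conj_simple {l : List B} {r b : B} (hl : cs.IsReduced l) (hr : r ∉ l)
    (h : cs.simple r * cs.wordProd l = cs.wordProd l * cs.simple b) :
    b = r ∧ ∀ a ∈ l, M r a = 2 := by
  have h0 : 0 ≤ geomRep cs (cs.wordProd l)⁻¹ (simpleRoot r) :=
    not_isLeftDescent_iff_root.1 (not_isLeftDescent_wordProd_of_notMem hr)
  have h1 : geomRep cs (cs.wordProd l)⁻¹ (simpleRoot r) = simpleRoot b := by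
    refine eq_simpleRoot_of_geomRefl_nonpos ((isRoot_simpleRoot r).map _) h0 ?_
    have e : cs.simple b * (cs.wordProd l)⁻¹ = (cs.wordProd l)⁻¹ * cs.simple r := by
      rw [eq_inv_mul_iff_mul_eq, ← mul_assoc, ← h]; group
    rw [← geomRep_simple cs, ← geomRep_mul_apply, e, geomRep_mul_apply, geomRep_simple,
      geomRefl_simpleRoot_self, map_neg]
    simpa using h0
  have h2 := geomRep_wordProd_inv_apply_of_notMem (cs := cs) hr (simpleRoot r)
  have hbr : b = r := by
    by_contra hne
    rw [h1] at h2
    simp [simpleRoot, Ne.symm hne] at h2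
  exact ⟨hbr, letters_commute_of_fixes hl hr (hbr ▸ h1)⟩

end Geometric

section Longest
variable [Fintype B] [DecidableEq B]

variable {cs : CoxeterSystem M W}

lemma geomRep_nonpos_of_forall_isRightDescent {u : W} (hu : ∀ s, cs.IsRightDescent u s)
    {x : B → ℝ} (hx : 0 ≤ x) : geomRep cs u x ≤ 0 := by
  have e : x = ∑ i, x i • simpleRoot i := by
    ext j; simp [simpleRoot, Pi.single_apply]
  rw [e, map_sum]
  refine Finset.sum_nonpos fun i _ => ?_
  rw [map_smul]
  exact smul_nonpos_of_nonneg_of_nonpos (hx i) (geomRep_simpleRoot_nonpos cs (hu i))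

lemma length_mul_of_forall_isRightDescent {u : W} (hu : ∀ s, cs.IsRightDescent u s) (v : W) :
    cs.length (u * v) + cs.length v = cs.length u := by
  induction hn : cs.length v generalizing v with
  | zero => rw [cs.length_eq_zero_iff] at hn; simp [hn]
  | succ n ih =>
    have hv : v ≠ 1 := by rintro rfl; simp at hn
    obtain ⟨s, hs⟩ := cs.exists_rightDescent_of_ne_one hv
    have h1 := cs.isRightDescent_iff.1 hs
    have h2 := ih (v * cs.simple s) (by omega)
    have h3 : cs.IsRightDescent (u * (v * cs.simple s)) s := by
      rw [isRightDescent_iff_root, geomRep_mul_apply]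
      refine geomRep_nonpos_of_forall_isRightDescent hu (geomRep_simpleRoot_nonneg cs ?_)
      exact cs.isRightDescent_iff_not_isRightDescent_mul.1 hs
    have h4 := cs.isRightDescent_iff.1 h3
    have h5 : u * (v * cs.simple s) * cs.simple s = u * v := by simp [mul_assoc]
    rw [h5] at h4
    omega

variable {w₀ : W} (hw₀ : ∀ u : W, cs.length u ≤ cs.length w₀)
include hw₀

omit [Fintype B] [DecidableEq B] in
lemma isRightDescent_longest (s : B) : cs.IsRightDescent w₀ s := by
  by_contra h
  have := hw₀ (w₀ * cs.simple s)
  rw [cs.not_isRightDescent_iff] at h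
  omega

omit [Fintype B] [DecidableEq B] in
lemma isLeftDescent_longest (s : B) : cs.IsLeftDescent w₀ s := by
  by_contra h
  have := hw₀ (cs.simple s * w₀)
  rw [cs.not_isLeftDescent_iff] at h
  omega

lemma length_longest_mul (v : W) : cs.length (w₀ * v) + cs.length v = cs.length w₀ :=
  length_mul_of_forall_isRightDescent (isRightDescent_longest hw₀) v

lemma longest_mul_self : w₀ * w₀ = 1 := by
  have := length_longest_mul hw₀ w₀
  rw [← cs.length_eq_zero_iff]; omega

lemma longest_inv : w₀⁻¹ = w₀ := inv_eq_of_mul_eq_one_left (longest_mul_self hw₀)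

lemma length_mul_longest (v : W) : cs.length (v * w₀) + cs.length v = cs.length w₀ := by
  have := length_longest_mul hw₀ v⁻¹
  rwa [← cs.length_inv (w₀ * v⁻¹), mul_inv_rev, longest_inv hw₀, inv_inv, cs.length_inv] at this

lemma isLeftDescent_mul_longest_iff (w : W) (s : B) :
    cs.IsLeftDescent (w * w₀) s ↔ ¬cs.IsLeftDescent w s := by
  have h1 := length_mul_longest hw₀ w
  have h2 := length_mul_longest hw₀ (cs.simple s * w)
  have h3 := cs.length_simple_mul w s
  rw [CoxeterSystem.IsLeftDescent, CoxeterSystem.IsLeftDescent, ← mul_assoc]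
  omega

lemma exists_simple_mul_longest (s : B) :
    ∃ b, cs.simple s * w₀ = w₀ * cs.simple b := by
  have h1 := length_longest_mul hw₀ (cs.simple s * w₀)
  have h2 := cs.isLeftDescent_iff.1 (isLeftDescent_longest hw₀ s)
  obtain ⟨b, hb⟩ := cs.length_eq_one_iff.1 (show cs.length (w₀ * (cs.simple s * w₀)) = 1 by omega)
  exact ⟨b, by rw [← hb, ← mul_assoc, longest_mul_self hw₀, one_mul]⟩

lemma exists_not_isRightDescent {u : W} (hu : u ≠ w₀) : ∃ b, ¬cs.IsRightDescent u b := by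
  by_contra! h
  have h1 := length_mul_of_forall_isRightDescent h (u⁻¹ * w₀)
  rw [mul_inv_cancel_left] at h1
  have h2 := hw₀ u
  have h3 : u⁻¹ * w₀ = 1 := by rw [← cs.length_eq_zero_iff]; omega
  exact hu (inv_mul_eq_one.1 h3)

end Longest

section Greedy

variable (cs : CoxeterSystem M W)

/-- The letters of `L` taken by the greedy procedure started at `w`. -/
def taken : List B → W → List B
  | [], _ => []
  | q :: L, w => if cs.length (cs.simple q * w) < cs.length w then
      q :: taken L (cs.simple q * w) else taken L w

/-- What remains of `w` after the greedy procedure along `L`. -/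
def rest : List B → W → W
  | [], w => w
  | q :: L, w => if cs.length (cs.simple q * w) < cs.length w then
      rest L (cs.simple q * w) else rest L w

/-- Along `L`, a letter that is once rejected is never taken afterwards. -/
def IsStable : List B → W → Prop
  | [], _ => True
  | q :: L, w => if cs.length (cs.simple q * w) < cs.length w then
      IsStable L (cs.simple q * w) else q ∉ taken cs L w ∧ IsStable L w

/-- The concatenation of `n` copies of the word `c`. -/
def iter (c : List B) : ℕ → List B
  | 0 => []
  | n + 1 => c ++ iter c n

lemma iter_succ' (c : List B) : ∀ n, iter c (n + 1) = iter c n ++ c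
  | 0 => by simp [iter]
  | n + 1 => by
    change c ++ iter c (n + 1) = c ++ iter c n ++ c
    rw [iter_succ' c n, List.append_assoc]

lemma iter_cons_succ (s : B) (c : List B) :
    ∀ n, iter (s :: c) (n + 1) = s :: (iter (c ++ [s]) n ++ c)
  | 0 => by simp [iter]
  | n + 1 => by rw [iter, iter_cons_succ s c n, iter]; simp

variable {cs}

section
variable {q : B} {w : W} {L : List B}

lemma taken_cons_pos (h : cs.IsLeftDescent w q) :
    taken cs (q :: L) w = q :: taken cs L (cs.simple q * w) := if_pos h

lemma taken_cons_neg (h : ¬cs.IsLeftDescent w q) :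
    taken cs (q :: L) w = taken cs L w := if_neg h

lemma rest_cons_pos (h : cs.IsLeftDescent w q) :
    rest cs (q :: L) w = rest cs L (cs.simple q * w) := if_pos h

lemma rest_cons_neg (h : ¬cs.IsLeftDescent w q) :
    rest cs (q :: L) w = rest cs L w := if_neg h

lemma isStable_cons_pos (h : cs.IsLeftDescent w q) :
    IsStable cs (q :: L) w ↔ IsStable cs L (cs.simple q * w) := by
  rw [IsStable, if_pos (show _ < _ from h)]

lemma isStable_cons_neg (h : ¬cs.IsLeftDescent w q) :
    IsStable cs (q :: L) w ↔ q ∉ taken cs L w ∧ IsStable cs L w := by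
  rw [IsStable, if_neg (show ¬_ < _ from h)]

end

lemma taken_append (L L' : List B) (w : W) :
    taken cs (L ++ L') w = taken cs L w ++ taken cs L' (rest cs L w) := by
  induction L generalizing w with
  | nil => simp [taken, rest]
  | cons q L ih =>
    by_cases h : cs.IsLeftDescent w q
    · simp [taken_cons_pos h, rest_cons_pos h, ih]
    · simp [taken_cons_neg h, rest_cons_neg h, ih]

lemma rest_append (L L' : List B) (w : W) :
    rest cs (L ++ L') w = rest cs L' (rest cs L w) := by
  induction L generalizing w with
  | nil => simp [rest]
  | cons q L ih =>
    by_cases h : cs.IsLeftDescent w q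
    · simp [rest_cons_pos h, ih]
    · simp [rest_cons_neg h, ih]

lemma IsStable.of_append {L L' : List B} {w : W} (h : IsStable cs (L ++ L') w) :
    IsStable cs L w := by
  induction L generalizing w with
  | nil => simp [IsStable]
  | cons q L ih =>
    rw [List.cons_append] at h
    by_cases hq : cs.IsLeftDescent w q
    · rw [isStable_cons_pos hq] at h ⊢
      exact ih h
    · rw [isStable_cons_neg hq, taken_append] at h
      rw [isStable_cons_neg hq]
      exact ⟨fun h' => h.1 (List.mem_append_left _ h'), ih h.2⟩

lemma wordProd_taken_mul_rest (L : List B) (w : W) :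
    cs.wordProd (taken cs L w) * rest cs L w = w := by
  induction L generalizing w with
  | nil => simp [taken, rest]
  | cons q L ih =>
    by_cases h : cs.IsLeftDescent w q
    · rw [taken_cons_pos h, rest_cons_pos h, wordProd_cons, mul_assoc, ih]; simp
    · rw [taken_cons_neg h, rest_cons_neg h, ih]

lemma length_taken_add (L : List B) (w : W) :
    (taken cs L w).length + cs.length (rest cs L w) = cs.length w := by
  induction L generalizing w with
  | nil => simp [taken, rest]
  | cons q L ih =>
    by_cases h : cs.IsLeftDescent w q
    · have h1 := cs.isLeftDescent_iff.1 h
      have h2 := ih (cs.simple q * w)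
      rw [taken_cons_pos h, rest_cons_pos h, List.length_cons]; omega
    · rw [taken_cons_neg h, rest_cons_neg h, ih]

lemma isReduced_taken (L : List B) (w : W) : cs.IsReduced (taken cs L w) := by
  have h1 := length_taken_add (cs := cs) L w
  have h2 := cs.length_mul_le (cs.wordProd (taken cs L w)) (rest cs L w)
  rw [wordProd_taken_mul_rest] at h2
  have h3 := cs.length_wordProd_le (taken cs L w)
  rw [CoxeterSystem.IsReduced]
  omega

lemma taken_sublist (L : List B) (w : W) : List.Sublist (taken cs L w) L := by
  induction L generalizing w with
  | nil => simp [taken]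
  | cons q L ih =>
    by_cases h : cs.IsLeftDescent w q
    · rw [taken_cons_pos h]; exact (ih _).cons_cons q
    · rw [taken_cons_neg h]; exact (ih _).cons q

lemma not_isLeftDescent_one (q : B) : ¬cs.IsLeftDescent 1 q := by
  simp [CoxeterSystem.IsLeftDescent]

lemma taken_one (L : List B) : taken cs L 1 = [] := by
  induction L with
  | nil => rfl
  | cons q L ih => rw [taken_cons_neg (not_isLeftDescent_one q), ih]

lemma rest_one (L : List B) : rest cs L 1 = 1 := by
  induction L with
  | nil => rfl
  | cons q L ih => rw [rest_cons_neg (not_isLeftDescent_one q), ih]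

lemma foldl_pass (c l : List B) (u : W) :
    c.foldl (fun p q =>
      if cs.length (cs.simple q * p.2) < cs.length p.2 then (p.1 ++ [q], cs.simple q * p.2)
      else p) (l, u) = (l ++ taken cs c u, rest cs c u) := by
  induction c generalizing l u with
  | nil => simp [taken, rest]
  | cons q c ih =>
    rw [List.foldl_cons]
    by_cases h : cs.IsLeftDescent u q
    · rw [taken_cons_pos h, rest_cons_pos h]
      rw [CoxeterSystem.IsLeftDescent] at h
      simp only [h, if_true, ih]; simp
    · rw [taken_cons_neg h, rest_cons_neg h]
      rw [CoxeterSystem.IsLeftDescent] at h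
      simp only [h, if_false, ih]

lemma pass_eq (c : List B) (u : W) : pass cs c u = (taken cs c u, rest cs c u) := by
  rw [pass, foldl_pass, List.nil_append]

lemma remainder_eq (c : List B) (w : W) (n : ℕ) : remainder cs c w n = rest cs (iter c n) w := by
  induction n with
  | zero => rfl
  | succ n ih => rw [remainder, pass_eq, ih, iter_succ', rest_append]

lemma factor_eq (c : List B) (w : W) (n : ℕ) :
    factor cs c w n = taken cs c (rest cs (iter c n) w) := by
  rw [factor, pass_eq, remainder_eq]

lemma factor_zero (c : List B) (w : W) : factor cs c w 0 = taken cs c w := by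
  rw [factor_eq]; rfl

lemma factor_succ (c : List B) (w : W) (n : ℕ) :
    factor cs c w (n + 1) = factor cs c (rest cs c w) n := by
  rw [factor_eq, factor_eq, iter, rest_append]

lemma flatten_factor (c : List B) (w : W) (n : ℕ) :
    ((List.range n).map (factor cs c w)).flatten = taken cs (iter c n) w := by
  induction n with
  | zero => rfl
  | succ n ih => rw [List.range_succ, iter_succ', taken_append, ← ih, ← factor_eq]; simp

lemma mem_taken_iter {c : List B} {w : W} {n : ℕ} {r : B} :
    r ∈ taken cs (iter c n) w ↔ ∃ k < n, r ∈ factor cs c w k := by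
  rw [← flatten_factor]
  simp

/-- A word in which each letter occurs exactly once. -/
def IsComplete (c : List B) : Prop := c.Nodup ∧ ∀ b, b ∈ c

lemma IsComplete.rotate {s : B} {c : List B} (h : IsComplete (s :: c)) : IsComplete (c ++ [s]) := by
  have hp : List.Perm (s :: c) (c ++ [s]) := (List.perm_append_singleton s c).symm
  exact ⟨hp.nodup_iff.1 h.1, fun b => hp.mem_iff.1 (h.2 b)⟩

lemma exists_isLeftDescent_of_taken_ne {c : List B} {w : W} {q : B} (hq : q ∈ c)
    (h : cs.IsLeftDescent w q) : taken cs c w ≠ [] := by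
  intro h0
  induction c with
  | nil => simp at hq
  | cons a c ih =>
    by_cases ha : cs.IsLeftDescent w a
    · simp [taken_cons_pos ha] at h0
    · rw [taken_cons_neg ha] at h0
      rcases List.mem_cons.1 hq with rfl | hq
      · exact ha h
      · exact ih hq h0

lemma rest_iter_eq_one {c : List B} (hc : IsComplete c) {n : ℕ} {w : W} (h : cs.length w ≤ n) :
    rest cs (iter c n) w = 1 := by
  induction n generalizing w with
  | zero => exact cs.length_eq_zero_iff.1 (by simpa [iter, rest] using h)
  | succ n ih =>
    rw [iter, rest_append]
    by_cases hw : w = 1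
    · subst hw; rw [rest_one, rest_one]
    obtain ⟨q, hq⟩ := cs.exists_leftDescent_of_ne_one hw
    have h1 := exists_isLeftDescent_of_taken_ne (hc.2 q) hq
    have h2 := length_taken_add (cs := cs) c w
    have h3 := List.length_pos_iff.2 h1
    exact ih (by omega)

lemma taken_iter {c : List B} (hc : IsComplete c) {n : ℕ} {w : W} (h : cs.length w ≤ n) :
    taken cs (iter c n) w = sortingWord cs c w := by
  rw [sortingWord, flatten_factor]
  obtain ⟨k, rfl⟩ := Nat.exists_eq_add_of_le h
  have : iter c (cs.length w + k) = iter c (cs.length w) ++ iter c k := by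
    clear h
    induction k with
    | zero => simp [iter]
    | succ k ih => rw [← add_assoc, iter_succ', ih, iter_succ', List.append_assoc]
  rw [this, taken_append, rest_iter_eq_one hc le_rfl, taken_one, List.append_nil]

lemma wordProd_sortingWord {c : List B} (hc : IsComplete c) (w : W) :
    cs.wordProd (sortingWord cs c w) = w := by
  rw [← taken_iter hc le_rfl]
  have := wordProd_taken_mul_rest (cs := cs) (iter c (cs.length w)) w
  rwa [rest_iter_eq_one hc le_rfl, mul_one] at this

lemma isReduced_sortingWord {c : List B} (hc : IsComplete c) (w : W) :
    cs.IsReduced (sortingWord cs c w) := by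
  rw [← taken_iter hc le_rfl]
  exact isReduced_taken _ _

lemma isStable_append_iff {c L : List B} (hc : c.Nodup) (w : W) :
    IsStable cs (c ++ L) w ↔ IsStable cs L (rest cs c w) ∧
      ∀ r ∈ c, r ∉ taken cs c w → r ∉ taken cs L (rest cs c w) := by
  induction c generalizing w with
  | nil => simp [rest]
  | cons q c ih =>
    rw [List.nodup_cons] at hc
    rw [List.cons_append]
    by_cases h : cs.IsLeftDescent w q
    · rw [isStable_cons_pos h, rest_cons_pos h, taken_cons_pos h, ih hc.2]
      grind
    · rw [isStable_cons_neg h, rest_cons_neg h, taken_cons_neg h, ih hc.2, taken_append]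
      have : q ∉ taken cs c w := fun h' => hc.1 ((taken_sublist c w).subset h')
      grind

lemma isSortable_iff_rest {c : List B} {w : W} :
    IsSortable cs c w ↔ (∀ q ∈ taken cs c (rest cs c w), q ∈ taken cs c w) ∧
      IsSortable cs c (rest cs c w) := by
  constructor
  · intro h
    refine ⟨fun q hq => ?_, fun n q hq => ?_⟩
    · have := h 0 q
      rw [factor_succ, factor_zero, factor_zero] at this
      exact this hq
    · rw [← factor_succ] at hq ⊢
      exact h (n + 1) q hq
  · rintro ⟨h0, h1⟩ n q hq
    rw [factor_succ] at hq
    cases n with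
    | zero => rw [factor_zero] at hq ⊢; exact h0 q hq
    | succ n => rw [factor_succ]; exact h1 n q hq

lemma IsSortable.factor_subset {c : List B} {w : W} (h : IsSortable cs c w) (n : ℕ) {q : B}
    (hq : q ∈ factor cs c w n) : q ∈ taken cs c w := by
  induction n with
  | zero => rwa [factor_zero] at hq
  | succ n ih => exact ih (h n q hq)

lemma isSortable_iff_isStable {c : List B} (hc : c.Nodup) {w : W} :
    IsSortable cs c w ↔ ∀ k, IsStable cs (iter c k) w := by
  constructor
  · intro h k
    induction k generalizing w with
    | zero => simp [iter, IsStable]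
    | succ k ih =>
      rw [iter, isStable_append_iff hc]
      refine ⟨ih (isSortable_iff_rest.1 h).2, fun r _ hr hr' => hr ?_⟩
      obtain ⟨n, -, hn⟩ := mem_taken_iter.1 hr'
      rw [← factor_succ] at hn
      exact h.factor_subset _ hn
  · intro h n
    induction n generalizing w with
    | zero =>
      intro q hq
      have h1 := h 2
      rw [iter, isStable_append_iff hc] at h1
      rw [factor_succ, factor_zero] at hq
      rw [factor_zero]
      by_contra hq'
      refine h1.2 q ((taken_sublist _ _).subset hq) hq' ?_
      rw [iter, taken_append]
      exact List.mem_append_left _ hq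
    | succ n ih =>
      rw [factor_succ, factor_succ c w n]
      refine ih fun k => ?_
      have h1 := h (k + 1)
      rw [iter, isStable_append_iff hc] at h1
      exact h1.1

lemma isSortable_cons_iff_of_isLeftDescent {s : B} {c : List B} {y : W} (hc : IsComplete (s :: c))
    (hs : cs.IsLeftDescent y s) :
    IsSortable cs (s :: c) y ↔ IsSortable cs (c ++ [s]) (cs.simple s * y) := by
  rw [isSortable_iff_isStable hc.1, isSortable_iff_isStable hc.rotate.1]
  constructor
  · intro h k
    have := h (k + 1)
    rw [iter_cons_succ, isStable_cons_pos hs] at this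
    exact this.of_append
  · intro h k
    cases k with
    | zero => simp [iter, IsStable]
    | succ k =>
      rw [iter_cons_succ, isStable_cons_pos hs]
      have := h (k + 1)
      rw [iter_succ', ← List.append_assoc] at this
      exact this.of_append

lemma IsSortable.rotate_of_not_isLeftDescent {s : B} {c : List B} {y : W}
    (hc : IsComplete (s :: c)) (hs : ¬cs.IsLeftDescent y s) (h : IsSortable cs (s :: c) y) :
    IsSortable cs (c ++ [s]) y ∧ ∃ L, s ∉ L ∧ cs.wordProd L = y := by
  rw [isSortable_iff_isStable hc.1] at h
  have h1 (k : ℕ) : s ∉ taken cs (iter (c ++ [s]) k) y ∧ IsStable cs (iter (c ++ [s]) k) y := by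
    have := h (k + 1)
    rw [iter_cons_succ, ← List.cons_append] at this
    exact (isStable_cons_neg hs).1 this.of_append
  refine ⟨(isSortable_iff_isStable hc.rotate.1).2 fun k => (h1 k).2, _, (h1 (cs.length y)).1, ?_⟩
  rw [taken_iter hc.rotate le_rfl, wordProd_sortingWord hc.rotate]

/-- A sortable element is a product of letters of its first factor. -/
lemma IsSortable.notMem_sortingWord {c : List B} {w : W} {r : B} (h : IsSortable cs c w)
    (hr : r ∉ taken cs c w) : r ∉ sortingWord cs c w := by
  rw [sortingWord, flatten_factor, mem_taken_iter]
  rintro ⟨k, -, hk⟩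
  exact hr (h.factor_subset k hk)

lemma isSortable_one (c : List B) : IsSortable cs c 1 := by
  intro n q hq
  rw [factor_eq, rest_one, taken_one] at hq
  simp at hq

/-- Induction along the rotations of a complete word. -/
theorem rotation_induction {motive : List B → W → Prop}
    (one : ∀ c, motive c 1)
    (descent : ∀ s c y, IsComplete (s :: c) → cs.IsLeftDescent y s →
      motive (c ++ [s]) (cs.simple s * y) → motive (s :: c) y)
    (ascent : ∀ s c y, IsComplete (s :: c) → ¬cs.IsLeftDescent y s →
      motive (c ++ [s]) y → motive (s :: c) y) :
    ∀ c y, IsComplete c → motive c y := by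
  intro c y hc
  induction hn : cs.length y using Nat.strong_induction_on generalizing c y with
  | _ n IH =>
    subst hn
    by_cases hy : y = 1
    · rw [hy]; exact one c
    obtain ⟨q, hq⟩ := cs.exists_leftDescent_of_ne_one hy
    obtain ⟨d, e, rfl⟩ := List.append_of_mem (hc.2 q)
    induction d generalizing e with
    | nil => exact descent q e y hc hq (IH _ hq _ _ hc.rotate rfl)
    | cons s d ih =>
      by_cases hs : cs.IsLeftDescent y s
      · exact descent s _ y hc hs (IH _ hs _ _ hc.rotate rfl)
      · refine ascent s _ y hc hs ?_
        have hc' : IsComplete (d ++ q :: e ++ [s]) := hc.rotate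
        change motive (d ++ q :: e ++ [s]) y
        rw [List.append_assoc, List.cons_append] at hc' ⊢
        exact ih _ hc'

end Greedy

section CommEquiv

lemma CommMove.symm {l l' : List B} (h : CommMove M l l') : CommMove M l' l := by
  obtain ⟨l₁, l₂, a, b, hab, rfl, rfl⟩ := h
  exact ⟨l₁, l₂, b, a, by rw [M.symmetric, hab], rfl, rfl⟩

lemma CommMove.append {l l' : List B} (h : CommMove M l l') (p q : List B) :
    CommMove M (p ++ l ++ q) (p ++ l' ++ q) := by
  obtain ⟨l₁, l₂, a, b, hab, rfl, rfl⟩ := h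
  exact ⟨p ++ l₁, l₂ ++ q, a, b, hab, by simp, by simp⟩

lemma CommMove.reverse {l l' : List B} (h : CommMove M l l') :
    CommMove M l.reverse l'.reverse := by
  obtain ⟨l₁, l₂, a, b, hab, rfl, rfl⟩ := h
  exact ⟨l₂.reverse, l₁.reverse, b, a, by rw [M.symmetric, hab], by simp, by simp⟩

lemma CommMove.perm {l l' : List B} (h : CommMove M l l') : l.Perm l' := by
  obtain ⟨l₁, l₂, a, b, -, rfl, rfl⟩ := h
  exact (List.Perm.swap b a l₂).append_left l₁

namespace CommEquiv

lemma refl (l : List B) : CommEquiv M l l := Relation.ReflTransGen.refl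

lemma symm {l l' : List B} (h : CommEquiv M l l') : CommEquiv M l' l := by
  induction h with
  | refl => exact refl _
  | tail _ h ih => exact .head h.symm ih

lemma trans {l l' l'' : List B} (h : CommEquiv M l l') (h' : CommEquiv M l' l'') :
    CommEquiv M l l'' := Relation.ReflTransGen.trans h h'

lemma append_both {l l' : List B} (h : CommEquiv M l l') (p q : List B) :
    CommEquiv M (p ++ l ++ q) (p ++ l' ++ q) := by
  induction h with
  | refl => exact refl _
  | tail _ h ih => exact .tail ih (h.append p q)

lemma append_left {l l' : List B} (h : CommEquiv M l l') (p : List B) :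
    CommEquiv M (p ++ l) (p ++ l') := by
  simpa using h.append_both p []

lemma append_right {l l' : List B} (h : CommEquiv M l l') (q : List B) :
    CommEquiv M (l ++ q) (l' ++ q) := by
  simpa using h.append_both [] q

lemma cons {l l' : List B} (h : CommEquiv M l l') (a : B) :
    CommEquiv M (a :: l) (a :: l') := h.append_left [a]

lemma append {l₁ l₁' l₂ l₂' : List B} (h : CommEquiv M l₁ l₁') (h' : CommEquiv M l₂ l₂') :
    CommEquiv M (l₁ ++ l₂) (l₁' ++ l₂') := (h.append_right _).trans (h'.append_left _)

lemma reverse {l l' : List B} (h : CommEquiv M l l') : CommEquiv M l.reverse l'.reverse := by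
  induction h with
  | refl => exact refl _
  | tail _ h ih => exact .tail ih h.reverse

lemma perm {l l' : List B} (h : CommEquiv M l l') : l.Perm l' := by
  induction h with
  | refl => exact .refl _
  | tail _ h ih => exact ih.trans h.perm

lemma swap {a b : B} (h : M a b = 2) (l : List B) : CommEquiv M (a :: b :: l) (b :: a :: l) :=
  .single ⟨[], l, a, b, h, rfl, rfl⟩

lemma cons_append {a : B} {p : List B} (h : ∀ x ∈ p, M a x = 2) (l : List B) :
    CommEquiv M (a :: (p ++ l)) (p ++ a :: l) := by
  induction p with
  | nil => exact refl _
  | cons x p ih =>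
    exact (swap (h x (by simp)) _).trans ((ih fun y hy => h y (by simp [hy])).cons x)

lemma append_singleton {a : B} {p : List B} (h : ∀ x ∈ p, M a x = 2) :
    CommEquiv M (a :: p) (p ++ [a]) := by
  simpa using cons_append h []

/-- A letter that can be moved to the front of a word. -/
lemma exists_of_cons {v z : List B} {a : B} (h : CommEquiv M v (a :: z)) :
    ∃ l₁ l₂, v = l₁ ++ a :: l₂ ∧ (∀ x ∈ l₁, M a x = 2) ∧ CommEquiv M (l₁ ++ l₂) z := by
  induction h using Relation.ReflTransGen.head_induction_on with
  | refl => exact ⟨[], z, rfl, by simp, refl _⟩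
  | head h _ ih =>
    obtain ⟨l₁, l₂, rfl, h1, h2⟩ := ih
    obtain ⟨m₁, m₂, x, y, hxy, rfl, e⟩ := h
    have hyx : M y x = 2 := by rw [M.symmetric, hxy]
    rcases List.append_eq_append_iff.1 e with ⟨t, rfl, ht⟩ | ⟨t, rfl, ht⟩
    · rcases t with _ | ⟨t1, t⟩
      · simp only [List.nil_append, List.cons.injEq] at ht
        obtain ⟨rfl, rfl⟩ := ht
        exact ⟨l₁ ++ [x], m₂, by simp, by simpa [or_imp, forall_and, hyx] using h1,
          by simpa using h2⟩
      · simp only [List.cons_append, List.cons.injEq] at ht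
        obtain ⟨rfl, rfl⟩ := ht
        refine ⟨l₁, t ++ x :: y :: m₂, by simp, h1, .trans ?_ h2⟩
        rw [← List.append_assoc, ← List.append_assoc]
        exact (swap hxy m₂).append_left _
    · rcases t with _ | ⟨t1, _ | ⟨t2, t⟩⟩
      · simp only [List.nil_append, List.cons.injEq] at ht
        obtain ⟨rfl, rfl⟩ := ht
        rw [List.append_nil] at h1 h2
        exact ⟨m₁ ++ [x], m₂, by simp, by simpa [or_imp, forall_and, hyx] using h1,
          by simpa using h2⟩
      · simp only [List.cons_append, List.nil_append, List.cons.injEq] at ht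
        obtain ⟨rfl, rfl, rfl⟩ := ht
        exact ⟨m₁, y :: m₂, by simp, fun b hb => h1 b (by simp [hb]), by simpa using h2⟩
      · simp only [List.cons_append, List.cons.injEq] at ht
        obtain ⟨rfl, rfl, rfl⟩ := ht
        refine ⟨m₁ ++ x :: y :: t, l₂, by simp, fun b hb => h1 b ?_, .trans ?_ h2⟩
        · simp only [List.mem_append, List.mem_cons] at hb ⊢; tauto
        · simpa using (swap hxy (t ++ l₂)).append_left m₁

/-- A letter that can be moved to the end of a word. -/
lemma exists_of_append_singleton {v z : List B} {b : B} (h : CommEquiv M v (z ++ [b])) :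
    ∃ l₁ l₂, v = l₁ ++ b :: l₂ ∧ (∀ x ∈ l₂, M b x = 2) ∧ CommEquiv M (l₁ ++ l₂) z := by
  have h1 := h.reverse
  rw [List.reverse_append, List.reverse_singleton, List.singleton_append] at h1
  obtain ⟨l₁, l₂, e, h2, h3⟩ := exists_of_cons h1
  refine ⟨l₂.reverse, l₁.reverse, ?_, by simpa using h2, by simpa using h3.reverse⟩
  rw [← List.reverse_inj, e]; simp

end CommEquiv

lemma simple_commute (cs : CoxeterSystem M W) {a b : B} (h : M a b = 2) :
    cs.simple a * cs.simple b = cs.simple b * cs.simple a := by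
  have h1 := cs.simple_mul_simple_pow a b
  rw [h, pow_two] at h1
  rw [mul_eq_one_iff_eq_inv] at h1
  rw [h1, mul_inv_rev, cs.inv_simple, cs.inv_simple]

lemma CommEquiv.wordProd_eq (cs : CoxeterSystem M W) {l l' : List B} (h : CommEquiv M l l') :
    cs.wordProd l = cs.wordProd l' := by
  induction h with
  | refl => rfl
  | tail _ h ih =>
    obtain ⟨l₁, l₂, a, b, hab, rfl, rfl⟩ := h
    rw [ih, wordProd_append, wordProd_append, wordProd_cons, wordProd_cons, wordProd_cons,
      wordProd_cons, ← mul_assoc (cs.simple a), simple_commute cs hab, mul_assoc]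

lemma CommEquiv.isReduced (cs : CoxeterSystem M W) {l l' : List B} (h : CommEquiv M l l')
    (hl : cs.IsReduced l) : cs.IsReduced l' := by
  rw [CoxeterSystem.IsReduced, ← h.wordProd_eq cs, ← h.perm.length_eq]
  exact hl

end CommEquiv

section GreedyGeometric
variable [Fintype B] [DecidableEq B] {cs : CoxeterSystem M W}

lemma isLeftDescent_simple_mul_iff {a b : B} (h : M a b = 2) (w : W) :
    cs.IsLeftDescent (cs.simple a * w) b ↔ cs.IsLeftDescent w b := by
  have hg : gram M a b = 0 := by simp [gram, h]
  rw [isLeftDescent_iff_root, isLeftDescent_iff_root, mul_inv_rev, cs.inv_simple,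
    geomRep_mul_apply, geomRep_simple, geomRefl_simpleRoot, hg]
  simp

lemma taken_rest_swap {a b : B} (h : M a b = 2) (w : W) :
    CommEquiv M (taken cs [a, b] w) (taken cs [b, a] w) ∧
      rest cs [a, b] w = rest cs [b, a] w := by
  have h' : M b a = 2 := by rw [M.symmetric, h]
  have h1 := isLeftDescent_simple_mul_iff (cs := cs) h w
  have h2 := isLeftDescent_simple_mul_iff (cs := cs) h' w
  by_cases ha : cs.IsLeftDescent w a <;> by_cases hb : cs.IsLeftDescent w b
  · have ha' := h2.2 ha
    have hb' := h1.2 hb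
    rw [taken_cons_pos ha, taken_cons_pos hb, taken_cons_pos hb', taken_cons_pos ha',
      rest_cons_pos ha, rest_cons_pos hb, rest_cons_pos hb', rest_cons_pos ha']
    refine ⟨CommEquiv.swap h _, ?_⟩
    rw [← mul_assoc, ← mul_assoc, simple_commute cs h]
  · have hb' := mt h1.1 hb
    rw [taken_cons_pos ha, taken_cons_neg hb, taken_cons_neg hb', taken_cons_pos ha,
      rest_cons_pos ha, rest_cons_neg hb, rest_cons_neg hb', rest_cons_pos ha]
    exact ⟨.refl _, rfl⟩
  · have ha' := mt h2.1 ha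
    rw [taken_cons_pos hb, taken_cons_neg ha, taken_cons_neg ha', taken_cons_pos hb,
      rest_cons_pos hb, rest_cons_neg ha, rest_cons_neg ha', rest_cons_pos hb]
    exact ⟨.refl _, rfl⟩
  · rw [taken_cons_neg ha, taken_cons_neg hb, taken_cons_neg hb, taken_cons_neg ha,
      rest_cons_neg ha, rest_cons_neg hb, rest_cons_neg hb, rest_cons_neg ha]
    exact ⟨.refl _, rfl⟩

lemma CommEquiv.taken_rest {L L' : List B} (h : CommEquiv M L L') (w : W) :
    CommEquiv M (taken cs L w) (taken cs L' w) ∧ rest cs L w = rest cs L' w := by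
  induction h with
  | refl => exact ⟨.refl _, rfl⟩
  | tail _ h ih =>
    obtain ⟨l₁, l₂, a, b, hab, rfl, rfl⟩ := h
    obtain ⟨h1, h2⟩ := taken_rest_swap (cs := cs) hab (rest cs l₁ w)
    have e (x y : B) : l₁ ++ x :: y :: l₂ = l₁ ++ ([x, y] ++ l₂) := rfl
    refine ⟨ih.1.trans ?_, ih.2.trans ?_⟩
    · rw [e, e, taken_append, taken_append, taken_append, taken_append, h2]
      exact (h1.append_right _).append_left _
    · rw [e, e, rest_append, rest_append, rest_append, rest_append, h2]

omit [Fintype B] [DecidableEq B] in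
lemma CommEquiv.iter {c c' : List B} (h : CommEquiv M c c') (n : ℕ) :
    CommEquiv M (iter c n) (iter c' n) := by
  induction n with
  | zero => exact refl _
  | succ n ih => exact h.append ih

lemma CommEquiv.mem_factor_iff {c c' : List B} (h : CommEquiv M c c') (w : W) (n : ℕ) (q : B) :
    q ∈ factor cs c w n ↔ q ∈ factor cs c' w n := by
  rw [factor_eq, factor_eq, ((h.iter n).taken_rest w).2]
  exact (h.taken_rest _).1.perm.mem_iff

lemma CommEquiv.isSortable_iff {c c' : List B} (h : CommEquiv M c c') (w : W) :
    IsSortable cs c w ↔ IsSortable cs c' w := by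
  simp only [IsSortable, h.mem_factor_iff]

lemma CommEquiv.isCSingleton_iff {c c' : List B} (h : CommEquiv M c c') (w₀ w : W) :
    IsCSingleton cs c w₀ w ↔ IsCSingleton cs c' w₀ w := by
  rw [IsCSingleton, IsCSingleton, h.isSortable_iff, h.reverse.isSortable_iff]

lemma CommEquiv.sortingWord {c c' : List B} (h : CommEquiv M c c') (w : W) :
    CommEquiv M (sortingWord cs c w) (sortingWord cs c' w) := by
  rw [CambrianPaper.sortingWord, CambrianPaper.sortingWord, flatten_factor, flatten_factor]
  exact ((h.iter _).taken_rest w).1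

omit [Fintype B] [DecidableEq B] in
lemma CommEquiv.isComplete {c c' : List B} (h : CommEquiv M c c') (hc : IsComplete c) :
    IsComplete c' :=
  ⟨h.perm.nodup_iff.1 hc.1, fun b => h.perm.mem_iff.1 (hc.2 b)⟩

variable (cs) in
/-- `WeakCovBy cs u' u` says that `u'` equals `u` or is covered by it in the right weak order. -/
def WeakCovBy (u' u : W) : Prop := u' = u ∨ ∃ b, cs.IsRightDescent u b ∧ u' = u * cs.simple b

omit [Fintype B] [DecidableEq B] in
lemma isRightDescent_simple_mul {u : W} {r b : B} (hb : cs.IsRightDescent u b)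
    (h : cs.IsLeftDescent u r ↔ cs.IsLeftDescent (u * cs.simple b) r) :
    cs.IsRightDescent (cs.simple r * u) b := by
  have h1 := cs.isRightDescent_iff.1 hb
  have h2 := cs.length_simple_mul u r
  have h3 := cs.length_simple_mul (u * cs.simple b) r
  rw [CoxeterSystem.IsLeftDescent, CoxeterSystem.IsLeftDescent] at h
  rw [CoxeterSystem.IsRightDescent, mul_assoc]
  omega

omit [Fintype B] [DecidableEq B] in
lemma isLeftDescent_of_mul_simple {u : W} {r b : B} (hb : cs.IsRightDescent u b)
    (h : cs.IsLeftDescent (u * cs.simple b) r) : cs.IsLeftDescent u r := by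
  have h1 := cs.isRightDescent_iff.1 hb
  have h2 := cs.isLeftDescent_iff.1 h
  have h3 := cs.length_mul_simple (cs.simple r * u) b
  have h4 := cs.length_simple_mul u r
  rw [CoxeterSystem.IsLeftDescent]
  rw [mul_assoc] at h3
  omega

lemma WeakCovBy.taken_rest {u' u : W} (h : WeakCovBy cs u' u) (L : List B) :
    WeakCovBy cs (rest cs L u') (rest cs L u) ∧ ∀ q ∈ taken cs L u', q ∈ taken cs L u := by
  induction L generalizing u' u with
  | nil => exact ⟨h, fun _ => id⟩
  | cons r L ih =>
    rcases h with rfl | ⟨b, hb, rfl⟩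
    · exact ⟨.inl rfl, fun _ => id⟩
    by_cases h1 : cs.IsLeftDescent u r <;> by_cases h2 : cs.IsLeftDescent (u * cs.simple b) r
    · rw [rest_cons_pos h1, rest_cons_pos h2, taken_cons_pos h1, taken_cons_pos h2]
      have := ih (u' := cs.simple r * (u * cs.simple b)) (u := cs.simple r * u)
        (.inr ⟨b, isRightDescent_simple_mul hb (by tauto), by rw [mul_assoc]⟩)
      refine ⟨this.1, fun q hq => ?_⟩
      rw [List.mem_cons] at hq ⊢
      exact hq.imp_right (this.2 q)
    · rw [rest_cons_pos h1, rest_cons_neg h2, taken_cons_pos h1, taken_cons_neg h2,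
        simple_mul_eq_mul_simple h1 h2]
      exact ⟨.inl rfl, fun q hq => List.mem_cons_of_mem _ hq⟩
    · exact absurd (isLeftDescent_of_mul_simple hb h2) h1
    · rw [rest_cons_neg h1, rest_cons_neg h2, taken_cons_neg h1, taken_cons_neg h2]
      exact ih (.inr ⟨b, hb, rfl⟩)

/-- How the greedy procedure changes when an element is replaced by one covering it. -/
lemma exists_insertion {u : W} {b : B} (hb : cs.IsRightDescent u b) {L : List B}
    (h : IsStable cs L (u * cs.simple b)) :
    (taken cs L u = taken cs L (u * cs.simple b) ∧ cs.IsRightDescent (rest cs L u) b) ∨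
    ∃ l₁ r l₂, taken cs L u = l₁ ++ r :: l₂ ∧ taken cs L (u * cs.simple b) = l₁ ++ l₂ ∧ r ∉ l₂ ∧
      cs.simple r * (cs.wordProd l₂ * rest cs L u) =
        cs.wordProd l₂ * rest cs L u * cs.simple b := by
  induction L generalizing u with
  | nil => exact .inl ⟨rfl, hb⟩
  | cons r L ih =>
    by_cases h1 : cs.IsLeftDescent u r <;> by_cases h2 : cs.IsLeftDescent (u * cs.simple b) r
    · rw [isStable_cons_pos h2, ← mul_assoc] at h
      rw [rest_cons_pos h1, taken_cons_pos h1, taken_cons_pos h2, ← mul_assoc]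
      rcases ih (isRightDescent_simple_mul hb (by tauto)) h with h3 | ⟨l₁, q, l₂, e1, e2, h3⟩
      · exact .inl ⟨by rw [h3.1], h3.2⟩
      · exact .inr ⟨r :: l₁, q, l₂, by rw [e1]; rfl, by rw [e2]; rfl, h3⟩
    · rw [isStable_cons_neg h2] at h
      have e := simple_mul_eq_mul_simple h1 h2
      rw [rest_cons_pos h1, taken_cons_pos h1, taken_cons_neg h2, e]
      refine .inr ⟨[], r, _, rfl, rfl, h.1, ?_⟩
      rw [wordProd_taken_mul_rest, ← e]
      rw [e]; simp [← mul_assoc, e]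
    · exact absurd (isLeftDescent_of_mul_simple hb h2) h1
    · rw [isStable_cons_neg h2] at h
      rw [rest_cons_neg h1, taken_cons_neg h1, taken_cons_neg h2]
      exact ih hb h.2

section Longest
variable {w₀ : W} (hw₀ : ∀ u : W, cs.length u ≤ cs.length w₀)
include hw₀

lemma factor_subset_factor_longest (c : List B) (u : W) (n : ℕ) :
    ∀ q ∈ factor cs c u n, q ∈ factor cs c w₀ n := by
  have chain (u : W) : Relation.ReflTransGen (WeakCovBy cs) u w₀ := by
    induction hn : cs.length w₀ - cs.length u generalizing u with
    | zero =>
      by_cases hu : u = w₀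
      · rw [hu]
      obtain ⟨b, hb⟩ := exists_not_isRightDescent hw₀ hu
      rw [cs.not_isRightDescent_iff] at hb
      have := hw₀ (u * cs.simple b)
      omega
    | succ n ih =>
      have hu : u ≠ w₀ := by rintro rfl; omega
      obtain ⟨b, hb⟩ := exists_not_isRightDescent hw₀ hu
      have hb' := cs.not_isRightDescent_iff.1 hb
      refine .head (.inr ⟨b, ?_, ?_⟩) (ih (u * cs.simple b) (by omega))
      · rw [cs.isRightDescent_iff_not_isRightDescent_mul]; simpa using hb
      · simp
  have mono (L : List B) {u v : W} (h : Relation.ReflTransGen (WeakCovBy cs) u v) :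
      Relation.ReflTransGen (WeakCovBy cs) (rest cs L u) (rest cs L v) ∧
        ∀ q ∈ taken cs L u, q ∈ taken cs L v := by
    induction h with
    | refl => exact ⟨.refl, fun _ => id⟩
    | tail _ h ih =>
      have := h.taken_rest L
      exact ⟨ih.1.tail this.1, fun q hq => this.2 q (ih.2 q hq)⟩
  intro q hq
  rw [factor_eq] at hq ⊢
  exact (mono c (mono (iter c n) (chain u)).1).2 q hq

/-- The longest element is `c`-sortable. -/
lemma isSortable_longest (c : List B) : IsSortable cs c w₀ := by
  intro n q hq
  rw [factor_succ] at hq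
  exact factor_subset_factor_longest hw₀ c _ n q hq

lemma taken_wordProd_inv_mul_longest {l L : List B} (h : (l ++ L).Nodup) :
    taken cs L ((cs.wordProd l)⁻¹ * w₀) = L := by
  induction L generalizing l with
  | nil => rfl
  | cons r L ih =>
    have hr : r ∉ l := by
      rw [List.nodup_append] at h
      intro hr
      exact h.2.2 r hr r (by simp) rfl
    rw [taken_cons_pos, List.cons_inj_right]
    · have := ih (l := l ++ [r]) (by simpa using h)
      rwa [wordProd_append, wordProd_singleton, mul_inv_rev, cs.inv_simple, mul_assoc] at this
    · rw [isLeftDescent_mul_longest_iff hw₀, ← wordProd_reverse]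
      exact not_isLeftDescent_wordProd_of_notMem (by simpa using hr)

lemma taken_longest {c : List B} (hc : c.Nodup) : taken cs c w₀ = c := by
  simpa using taken_wordProd_inv_mul_longest hw₀ (l := []) hc

lemma exists_sortingWord_longest_eq_append {c : List B} (hc : IsComplete c) :
    ∃ L, sortingWord cs c w₀ = c ++ L := by
  rw [← taken_iter hc (Nat.le_succ _), iter, taken_append, taken_longest hw₀ hc.1]
  exact ⟨_, rfl⟩

omit [Fintype B] [DecidableEq B] in
lemma sortingWord_longest_cons {s : B} {c : List B} (hc : IsComplete (s :: c)) :
    sortingWord cs (s :: c) w₀ = s :: sortingWord cs (c ++ [s]) (cs.simple s * w₀) := by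
  have h := isLeftDescent_longest hw₀ s
  rw [← taken_iter hc (Nat.le_succ _), iter_cons_succ, taken_cons_pos h, taken_append,
    rest_iter_eq_one hc.rotate h.le, taken_one, List.append_nil, taken_iter hc.rotate h.le]

/-- Comparison of the sorting words of the longest element for a word and its rotation. -/
lemma sortingWord_longest_rotate {s b : B} {c : List B} (hc : IsComplete (s :: c))
    (hb : cs.simple s * w₀ = w₀ * cs.simple b) :
    CommEquiv M (sortingWord cs (c ++ [s]) w₀)
      (sortingWord cs (c ++ [s]) (cs.simple s * w₀) ++ [b]) := by
  have hs := isLeftDescent_longest hw₀ s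
  have h1 : IsSortable cs (c ++ [s]) (cs.simple s * w₀) :=
    (isSortable_cons_iff_of_isLeftDescent hc hs).1 (isSortable_longest hw₀ _)
  have h2 := (isSortable_iff_isStable hc.rotate.1).1 h1 (cs.length w₀)
  rw [hb] at h2
  have h3 := rest_iter_eq_one (cs := cs) hc.rotate (le_refl (cs.length w₀))
  have h4 : taken cs (iter (c ++ [s]) (cs.length w₀)) (w₀ * cs.simple b) =
      sortingWord cs (c ++ [s]) (w₀ * cs.simple b) := taken_iter hc.rotate (hw₀ _)
  rcases exists_insertion (isRightDescent_longest hw₀ b) h2 with ⟨-, h⟩ | ⟨l₁, r, l₂, e1, e2, hr, h⟩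
  · rw [h3] at h
    simp [CoxeterSystem.IsRightDescent] at h
  · rw [h3, mul_one] at h
    have hl : cs.IsReduced l₂ := by
      have := (isReduced_taken (cs := cs) (iter (c ++ [s]) (cs.length w₀)) (w₀ * cs.simple b)).drop
        l₁.length
      rwa [e2, List.drop_left] at this
    obtain ⟨rfl, h5⟩ := commute_of_conj_simple hl hr h
    rw [hb, ← h4, e2, ← taken_iter hc.rotate le_rfl, e1, List.append_assoc]
    exact (CommEquiv.append_singleton h5).append_left _

end Longest
end GreedyGeometric

section EulerForm

variable (M) in
/-- The part of (minus) the canonical bilinear pairing with `s` supported on the word `c`. -/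
def partialPairing (s : B) (c : List B) (y : B → ℝ) : ℝ := (c.map fun j => gram M s j * y j).sum

variable (M) in
/-- The strictly upper triangular part, for the order of the letters in `c`, of (minus) the
canonical bilinear form. -/
def eulerForm : List B → (B → ℝ) → (B → ℝ) → ℝ
  | [], _, _ => 0
  | s :: c, x, y => x s * partialPairing M s c y + eulerForm c x y

variable (M) in
/-- The skew-symmetric form attached to a word. -/
def skewForm (c : List B) (x y : B → ℝ) : ℝ := eulerForm M c x y - eulerForm M c y x

variable {c : List B} {s : B} {x y x' y' : B → ℝ}

lemma partialPairing_congr (h : ∀ j ∈ c, y j = y' j) :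
    partialPairing M s c y = partialPairing M s c y' := by
  rw [partialPairing, partialPairing]
  congr 1
  exact List.map_congr_left fun j hj => by rw [h j hj]

lemma partialPairing_eq_zero (h : ∀ j ∈ c, y j = 0) : partialPairing M s c y = 0 := by
  rw [partialPairing_congr (y' := 0) h]
  simp [partialPairing]

lemma partialPairing_nonneg (hs : s ∉ c) (hy : 0 ≤ y) : 0 ≤ partialPairing M s c y := by
  refine List.sum_nonneg fun r hr => ?_
  obtain ⟨j, hj, rfl⟩ := List.mem_map.1 hr
  exact mul_nonneg (gram_nonneg (by rintro rfl; exact hs hj)) (hy j)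

lemma eulerForm_congr (hx : ∀ j ∈ c, x j = x' j) (hy : ∀ j ∈ c, y j = y' j) :
    eulerForm M c x y = eulerForm M c x' y' := by
  induction c with
  | nil => rfl
  | cons s c ih =>
    simp only [List.mem_cons, forall_eq_or_imp] at hx hy
    rw [eulerForm, eulerForm, hx.1, partialPairing_congr hy.2, ih hx.2 hy.2]

lemma eulerForm_eq_zero_left (hx : ∀ j ∈ c, x j = 0) : eulerForm M c x y = 0 := by
  induction c with
  | nil => rfl
  | cons s c ih =>
    simp only [List.mem_cons, forall_eq_or_imp] at hx
    rw [eulerForm, hx.1, ih hx.2]; simp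

lemma eulerForm_eq_zero_right (hy : ∀ j ∈ c, y j = 0) : eulerForm M c x y = 0 := by
  induction c with
  | nil => rfl
  | cons s c ih =>
    simp only [List.mem_cons, forall_eq_or_imp] at hy
    rw [eulerForm, partialPairing_eq_zero hy.2, ih hy.2]; simp

lemma eulerForm_append_of_eq_zero {d : List B} (hx : ∀ j ∈ d, x j = 0) :
    eulerForm M (d ++ c) x y = eulerForm M c x y := by
  induction d with
  | nil => rfl
  | cons s d ih =>
    simp only [List.mem_cons, forall_eq_or_imp] at hx
    rw [List.cons_append, eulerForm, hx.1, ih hx.2]; simp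

lemma eulerForm_append_singleton :
    eulerForm M (c ++ [s]) x y = eulerForm M c x y + y s * partialPairing M s c x := by
  induction c with
  | nil => simp [eulerForm, partialPairing]
  | cons a c ih =>
    rw [List.cons_append, eulerForm, eulerForm, ih]
    simp only [partialPairing, List.map_append, List.sum_append, List.map_cons, List.sum_cons,
      List.map_nil, List.sum_nil, gram_symm (M := M) s a]
    ring

variable [Fintype B] [DecidableEq B] {cs : CoxeterSystem M W}

lemma partialPairing_eq (hc : IsComplete (s :: c)) :
    partialPairing M s c y = y s - pairing M s y := by
  have h : ∑ j, gram M s j * y j = ((s :: c).map fun j => gram M s j * y j).sum := by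
    rw [← List.sum_toFinset _ hc.1]
    congr 1
    ext b
    simpa using List.mem_cons.1 (hc.2 b)
  rw [pairing_apply, h, List.map_cons, List.sum_cons, gram_self, partialPairing]
  ring

lemma skewForm_rotate_geomRefl (hc : IsComplete (s :: c)) :
    skewForm M (c ++ [s]) (geomRefl M s x) (geomRefl M s y) = skewForm M (s :: c) x y := by
  have hs : s ∉ c := (List.nodup_cons.1 hc.1).1
  have h (z : B → ℝ) : ∀ j ∈ c, geomRefl M s z j = z j := fun j hj =>
    geomRefl_apply_of_ne (by rintro rfl; exact hs hj) z
  rw [skewForm, skewForm, eulerForm_append_singleton, eulerForm_append_singleton,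
    eulerForm_congr (h x) (h y), eulerForm_congr (h y) (h x), partialPairing_congr (h x),
    partialPairing_congr (h y), geomRefl_apply_self, geomRefl_apply_self, eulerForm, eulerForm,
    partialPairing_eq hc, partialPairing_eq hc]
  ring

omit [Fintype B] [DecidableEq B] in
lemma skewForm_rotate_of_eq_zero (hx : x s = 0) (hy : y s = 0) :
    skewForm M (c ++ [s]) x y = skewForm M (s :: c) x y := by
  rw [skewForm, skewForm, eulerForm_append_singleton, eulerForm_append_singleton, eulerForm,
    eulerForm, hx, hy]
  ring

omit [Fintype B] in
lemma skewForm_simpleRoot_right_nonpos (hs : s ∉ c) (hx : 0 ≤ x) :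
    skewForm M (s :: c) x (simpleRoot s) ≤ 0 := by
  have h : ∀ j ∈ c, simpleRoot s j = 0 := fun j hj => by
    have : j ≠ s := by rintro rfl; exact hs hj
    simp [simpleRoot, this]
  rw [skewForm, eulerForm, eulerForm, partialPairing_eq_zero h, eulerForm_eq_zero_right h,
    eulerForm_eq_zero_left h]
  have := partialPairing_nonneg (M := M) hs hx
  simpa [simpleRoot] using this

omit [Fintype B] in
lemma skewForm_simpleRoot_simpleRoot {d e : List B} {q : B} (hnd : (d ++ q :: e).Nodup)
    (hs : s ∈ e) : skewForm M (d ++ q :: e) (simpleRoot q) (simpleRoot s) = gram M q s := by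
  obtain ⟨f, g, rfl⟩ := List.append_of_mem hs
  have h1 {l : List B} {a : B} (ha : a ∉ l) : ∀ j ∈ l, simpleRoot a j = 0 := fun j hj => by
    have : j ≠ a := by rintro rfl; exact ha hj
    simp [simpleRoot, this]
  have hq : q ∉ d ∧ q ∉ f ∧ q ∉ g ∧ q ≠ s := by grind
  have hs : s ∉ d ∧ s ∉ f ∧ s ∉ g := by grind
  rw [skewForm, eulerForm_append_of_eq_zero (h1 hq.1), eulerForm_append_of_eq_zero (h1 hs.1),
    eulerForm, eulerForm, eulerForm_eq_zero_left (h1 (by simp; tauto)),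
    eulerForm_append_of_eq_zero (h1 hs.2.1), eulerForm, eulerForm_eq_zero_left (h1 hs.2.2),
    partialPairing_eq_zero (c := g) (h1 hq.2.2.1)]
  have h2 : partialPairing M q (f ++ s :: g) (simpleRoot s) = gram M q s := by
    have h3 := partialPairing_eq_zero (M := M) (s := q) (h1 hs.2.1)
    have h4 := partialPairing_eq_zero (M := M) (s := q) (h1 hs.2.2)
    rw [partialPairing] at h3 h4 ⊢
    rw [List.map_append, List.sum_append, List.map_cons, List.sum_cons, h3, h4]
    simp [simpleRoot]
  rw [h2]
  simp [simpleRoot, hq.2.2.2]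

/-- The alignment obstruction for sortable elements. -/
lemma IsSortable.not_aligned (c : List B) (y : W) (hc : IsComplete c) :
    IsSortable cs c y → ∀ (γ δ : B → ℝ) (m : ℝ), IsRoot cs γ → IsRoot cs δ → 0 ≤ γ → 0 ≤ δ →
      0 < m → geomRep cs y⁻¹ γ ≤ 0 → 0 ≤ geomRep cs y⁻¹ δ → geomRep cs y⁻¹ (γ + m • δ) ≤ 0 →
      skewForm M c δ γ ≤ 0 := by
  refine rotation_induction (cs := cs) (motive := fun c y => IsSortable cs c y →
    ∀ (γ δ : B → ℝ) (m : ℝ), IsRoot cs γ → IsRoot cs δ → 0 ≤ γ → 0 ≤ δ →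
      0 < m → geomRep cs y⁻¹ γ ≤ 0 → 0 ≤ geomRep cs y⁻¹ δ → geomRep cs y⁻¹ (γ + m • δ) ≤ 0 →
      skewForm M c δ γ ≤ 0) ?_ ?_ ?_ c y hc
  · intro c _ γ δ m hγ _ hγ0 _ _ h
    refine absurd (le_antisymm ?_ hγ0) hγ.ne_zero
    simpa using h
  · intro s c y hc hs ih hy γ δ m hγ hδ hγ0 hδ0 hm h1 h2 h3
    by_contra! hω
    have hγs : γ ≠ simpleRoot s := by
      rintro rfl
      exact absurd (skewForm_simpleRoot_right_nonpos (List.nodup_cons.1 hc.1).1 hδ0) (not_le.2 hω)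
    have hδs : δ ≠ simpleRoot s := by
      rintro rfl
      exact (hδ.map y⁻¹).ne_zero (le_antisymm (isLeftDescent_iff_root.1 hs) h2)
    have e (x : B → ℝ) : geomRep cs (cs.simple s * y)⁻¹ (geomRefl M s x) = geomRep cs y⁻¹ x := by
      rw [← geomRep_simple cs, ← geomRep_mul_apply]; simp
    have := ih ((isSortable_cons_iff_of_isLeftDescent hc hs).1 hy) (geomRefl M s γ)
      (geomRefl M s δ) m (by simpa using hγ.map (cs.simple s)) (by simpa using hδ.map (cs.simple s))
      (hγ.geomRefl_nonneg hγ0 hγs) (hδ.geomRefl_nonneg hδ0 hδs) hm (by rwa [e]) (by rwa [e])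
      (by rwa [← map_smul, ← map_add, e])
    rw [skewForm_rotate_geomRefl hc] at this
    exact absurd this (not_le.2 hω)
  · intro s c y hc hs ih hy γ δ m hγ hδ hγ0 hδ0 hm h1 h2 h3
    obtain ⟨h4, L, hL, rfl⟩ := hy.rotate_of_not_isLeftDescent hc hs
    have h5 := h1 s
    have h6 := h3 s
    rw [geomRep_wordProd_inv_apply_of_notMem hL] at h5 h6
    have h7 := hγ0 s
    have h8 := hδ0 s
    simp only [Pi.add_apply, Pi.smul_apply, smul_eq_mul, Pi.zero_apply] at h5 h6 h7 h8
    have h9 : γ s = 0 := le_antisymm h5 h7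
    have h10 : δ s = 0 := by nlinarith
    rw [← skewForm_rotate_of_eq_zero h10 h9]
    exact ih h4 γ δ m hγ hδ hγ0 hδ0 hm h1 h2 h3

omit [Fintype B] [DecidableEq B] in
lemma exists_first_mem {P : B → Prop} {c : List B} (h : ∃ q ∈ c, P q) :
    ∃ p q p', c = p ++ q :: p' ∧ P q ∧ ∀ x ∈ p, ¬P x := by
  induction c with
  | nil => simp at h
  | cons a c ih =>
    by_cases ha : P a
    · exact ⟨[], a, c, rfl, ha, by simp⟩
    · obtain ⟨q, hq, hP⟩ := h
      have hq : q ∈ c := (List.mem_cons.1 hq).resolve_left (by rintro rfl; exact ha hP)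
      obtain ⟨p, q, p', rfl, h1, h2⟩ := ih ⟨q, hq, hP⟩
      exact ⟨a :: p, q, p', rfl, h1, by simpa [ha] using h2⟩

omit [Fintype B] [DecidableEq B] in
lemma taken_append_of_forall_not {p : List B} {w : W} (h : ∀ x ∈ p, ¬cs.IsLeftDescent w x)
    (L : List B) : taken cs (p ++ L) w = taken cs L w := by
  induction p with
  | nil => rfl
  | cons a p ih =>
    rw [List.cons_append, taken_cons_neg (h a (by simp)), ih fun x hx => h x (by simp [hx])]

variable {w₀ : W} (hw₀ : ∀ u : W, cs.length u ≤ cs.length w₀)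
include hw₀

/-- A nontrivial singleton has a left descent that is initial in `c` up to commutations. -/
lemma IsCSingleton.exists_initial {c : List B} (hc : IsComplete c) {w : W} (hw : w ≠ 1)
    (h : IsCSingleton cs c w₀ w) :
    ∃ p a p', c = p ++ a :: p' ∧ cs.IsLeftDescent w a ∧ ∀ x ∈ p, M a x = 2 := by
  obtain ⟨q, hq⟩ := cs.exists_leftDescent_of_ne_one hw
  obtain ⟨p, q, p', rfl, hq, hp⟩ := exists_first_mem (P := cs.IsLeftDescent w) ⟨q, hc.2 q, hq⟩
  refine ⟨p, q, p', rfl, hq, fun s hs => ?_⟩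
  by_contra hM
  have hnd := hc.1
  have hqs : q ≠ s := by rintro rfl; exact hp q hs hq
  have hsp : s ∉ q :: p' := by
    rw [List.nodup_append] at hnd
    exact fun h => hnd.2.2 s hs s h rfl
  have hL := h.1.notMem_sortingWord (r := s) fun h' => by
    rw [taken_append_of_forall_not hp] at h'
    exact hsp ((taken_sublist _ _).subset h')
  have hcoord (x : B → ℝ) : geomRep cs w⁻¹ x s = x s := by
    simpa only [wordProd_sortingWord hc w] using
      geomRep_wordProd_inv_apply_of_notMem (cs := cs) hL x
  have hg : 0 < gram M q s :=
    lt_of_le_of_ne (gram_nonneg hqs) fun h0 => hM (gram_eq_zero hqs h0.symm)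
  have hm : 0 < 2 * gram M q s := by positivity
  have e : (w * w₀)⁻¹ = w₀ * w⁻¹ := by rw [mul_inv_rev, longest_inv hw₀]
  have hneg {x : B → ℝ} (hx : 0 ≤ geomRep cs w⁻¹ x) : geomRep cs (w * w₀)⁻¹ x ≤ 0 := by
    rw [e, geomRep_mul_apply]
    exact geomRep_nonpos_of_forall_isRightDescent (isRightDescent_longest hw₀) hx
  have h1 := IsSortable.not_aligned (cs := cs) _ _
    (⟨List.nodup_reverse.2 hc.1, fun b => List.mem_reverse.2 (hc.2 b)⟩) h.2
    (simpleRoot s) (simpleRoot q) (2 * gram M q s)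
    (isRoot_simpleRoot s) (isRoot_simpleRoot q) (simpleRoot_nonneg s) (simpleRoot_nonneg q) hm
    (hneg (not_isLeftDescent_iff_root.1 (hp s hs)))
    (by
      have h2 := hneg (x := -simpleRoot q) (by simpa using isLeftDescent_iff_root.1 hq)
      simpa using h2)
    (hneg (by
      rw [← geomRefl_simpleRoot, ← geomRep_simple cs]
      refine (((isRoot_simpleRoot s).map _).map w⁻¹).nonneg_of_pos (i := s) ?_
      rw [hcoord, geomRep_simple, geomRefl_apply_of_ne hqs.symm]
      simp [simpleRoot]))
  have e2 : (p ++ q :: p').reverse = p'.reverse ++ q :: p.reverse := by simp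
  rw [e2, skewForm_simpleRoot_simpleRoot (by rw [← e2]; exact List.nodup_reverse.2 hc.1)
    (List.mem_reverse.2 hs)] at h1
  exact absurd h1 (not_le.2 hg)

end EulerForm

section Singleton
variable [Fintype B] [DecidableEq B] {cs : CoxeterSystem M W}
variable {w₀ : W} (hw₀ : ∀ u : W, cs.length u ≤ cs.length w₀)
include hw₀

/-- Rotating an initial letter of `c` that is a left descent of `w` preserves singletons. -/
lemma isCSingleton_cons_iff {a : B} {c : List B} (hc : IsComplete (a :: c)) {w : W}
    (ha : cs.IsLeftDescent w a) :
    IsCSingleton cs (a :: c) w₀ w ↔ IsCSingleton cs (c ++ [a]) w₀ (cs.simple a * w) := by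
  have hc' : IsComplete (a :: c.reverse) :=
    ⟨by simpa using hc.1, fun b => by simpa using hc.2 b⟩
  have h1 : cs.IsLeftDescent (cs.simple a * w * w₀) a := by
    rw [isLeftDescent_mul_longest_iff hw₀]
    exact cs.isLeftDescent_iff_not_isLeftDescent_mul.1 ha
  have h2 := isSortable_cons_iff_of_isLeftDescent hc' h1
  rw [mul_assoc, cs.simple_mul_simple_cancel_left] at h2
  rw [IsCSingleton, IsCSingleton, isSortable_cons_iff_of_isLeftDescent hc ha,
    List.reverse_cons, List.reverse_append, List.reverse_singleton, List.singleton_append,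
    mul_assoc, h2]

lemma isCSingleton_of_commEquiv {c : List B} (hc : IsComplete c) {u z : List B}
    (h : CommEquiv M (sortingWord cs c w₀) (u ++ z)) :
    IsCSingleton cs c w₀ (cs.wordProd u) := by
  induction u generalizing c z with
  | nil =>
    rw [cs.wordProd_nil, IsCSingleton, one_mul]
    exact ⟨isSortable_one c, isSortable_longest hw₀ _⟩
  | cons a u ih =>
    have hnot {l : List B} (hl : ∀ x ∈ l, M a x = 2) : a ∉ l := fun ha => by
      simpa using hl a ha
    obtain ⟨l₁, l₂, e, h1, h2⟩ := CommEquiv.exists_of_cons h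
    obtain ⟨L, hL⟩ := exists_sortingWord_longest_eq_append hw₀ hc
    obtain ⟨p', rfl⟩ : ∃ p', c = l₁ ++ a :: p' := by
      obtain ⟨p, p', rfl⟩ := List.append_of_mem (hc.2 a)
      rw [hL] at e
      have hp : a ∉ p := by
        have := hc.1
        rw [List.nodup_append] at this
        exact fun h => this.2.2 a h a (by simp) rfl
      rw [List.append_assoc, List.cons_append] at e
      obtain ⟨rfl, -⟩ : p = l₁ ∧ _ := by
        rcases List.append_eq_append_iff.1 e with ⟨t, rfl, ht⟩ | ⟨t, rfl, ht⟩
        · rcases t with _ | ⟨x, t⟩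
          · simp at ht ⊢
            exact ht
          · simp only [List.cons_append, List.cons.injEq] at ht
            exact absurd (by simp [← ht.1]) (hnot h1)
        · rcases t with _ | ⟨x, t⟩
          · simp at ht ⊢
            exact ht.symm
          · simp only [List.cons_append, List.cons.injEq] at ht
            exact absurd (by simp [← ht.1]) hp
      exact ⟨p', rfl⟩
    have hcc : CommEquiv M (l₁ ++ a :: p') (a :: (l₁ ++ p')) := (CommEquiv.cons_append h1 p').symm
    have hc' := hcc.isComplete hc
    obtain ⟨b, hb⟩ := exists_simple_mul_longest hw₀ a
    have h3 := (hcc.sortingWord (cs := cs) w₀).symm.trans h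
    have hred : cs.IsReduced (a :: (u ++ z)) := h3.isReduced cs (isReduced_sortingWord hc' w₀)
    rw [sortingWord_longest_cons hw₀ hc', List.cons_append] at h3
    obtain ⟨m₁, m₂, e', h4, h5⟩ := CommEquiv.exists_of_cons h3
    have h6 : CommEquiv M (sortingWord cs (l₁ ++ p' ++ [a]) (cs.simple a * w₀)) (u ++ z) := by
      rcases m₁ with _ | ⟨x, m₁⟩
      · simp only [List.nil_append, List.cons.injEq, true_and] at e' h5
        rwa [e']
      · simp only [List.cons_append, List.cons.injEq] at e'
        exact absurd (by simp [← e'.1]) (hnot h4)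
    have h7 := (sortingWord_longest_rotate hw₀ hc' hb).trans (h6.append_right [b])
    rw [List.append_assoc u] at h7
    have h8 := ih hc'.rotate h7
    have hd : cs.IsLeftDescent (cs.wordProd (a :: u)) a := by
      have := hred.take (u.length + 1)
      rw [List.take_succ_cons, List.take_left] at this
      rw [CoxeterSystem.IsLeftDescent, this, cs.wordProd_cons, cs.simple_mul_simple_cancel_left]
      exact (cs.length_wordProd_le u).trans_lt (by simp)
    rw [hcc.isCSingleton_iff, isCSingleton_cons_iff hw₀ hc' hd, cs.wordProd_cons,
      cs.simple_mul_simple_cancel_left]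
    exact h8

lemma IsCSingleton.exists_commEquiv {c : List B} (hc : IsComplete c) {w : W}
    (h : IsCSingleton cs c w₀ w) :
    ∃ u z, CommEquiv M (sortingWord cs c w₀) (u ++ z) ∧ cs.wordProd u = w := by
  induction hn : cs.length w generalizing c w with
  | zero =>
    obtain rfl := cs.length_eq_zero_iff.1 hn
    exact ⟨[], _, .refl _, cs.wordProd_nil⟩
  | succ n ih =>
    have hw : w ≠ 1 := by rintro rfl; simp at hn
    obtain ⟨p, a, p', rfl, ha, hp⟩ := h.exists_initial hw₀ hc hw
    have hcc : CommEquiv M (p ++ a :: p') (a :: (p ++ p')) := (CommEquiv.cons_append hp p').symm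
    have hc' := hcc.isComplete hc
    have hl := cs.isLeftDescent_iff.1 ha
    rw [hcc.isCSingleton_iff, isCSingleton_cons_iff hw₀ hc' ha] at h
    obtain ⟨u, z, h1, hu⟩ := ih hc'.rotate h (by omega)
    have hred := h1.isReduced cs (isReduced_sortingWord hc'.rotate w₀)
    obtain ⟨b, hb⟩ := exists_simple_mul_longest hw₀ a
    have h2 := h1.symm.trans (sortingWord_longest_rotate hw₀ hc' hb)
    obtain ⟨l₁, l₂, e, h3, h4⟩ := CommEquiv.exists_of_append_singleton h2
    have h5 := hcc.sortingWord (cs := cs) w₀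
    rw [sortingWord_longest_cons hw₀ hc'] at h5
    have hlast {t : List B} (hut : u = l₁ ++ b :: t) (hl₂ : l₂ = t ++ z) : False := by
      subst hl₂
      have h7 := h4.wordProd_eq cs
      have h8 := h1.wordProd_eq cs
      rw [wordProd_sortingWord hc'.rotate] at h7 h8
      rw [← List.append_assoc, cs.wordProd_append] at h7
      rw [cs.wordProd_append] at h8
      have h9 : cs.simple a * cs.wordProd u = cs.wordProd (l₁ ++ t) := by
        apply mul_right_cancel (b := cs.wordProd z)
        rw [h7, mul_assoc, ← h8]
      rw [hu, cs.simple_mul_simple_cancel_left] at h9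
      have h10 := cs.length_wordProd_le (l₁ ++ t)
      have h11 : cs.length (cs.wordProd u) = u.length := by
        have := hred.take u.length
        rwa [List.take_left] at this
      rw [← h9] at h10
      rw [hu, hut] at h11
      simp at h10 h11
      omega
    rcases List.append_eq_append_iff.1 e with ⟨t, rfl, ht⟩ | ⟨t, hut, ht⟩
    · refine ⟨a :: u, t ++ l₂, h5.trans ?_, ?_⟩
      · rw [List.append_assoc] at h4
        exact h4.symm.cons a
      · rw [cs.wordProd_cons, hu, cs.simple_mul_simple_cancel_left]
    · rcases t with _ | ⟨x, t⟩
      · rw [List.append_nil] at hut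
        subst hut
        refine ⟨a :: u, l₂, h5.trans (h4.symm.cons a), ?_⟩
        rw [cs.wordProd_cons, hu, cs.simple_mul_simple_cancel_left]
      · rw [List.cons_append, List.cons.injEq] at ht
        exact (hlast (hut.trans (by rw [ht.1])) ht.2).elim

end Singleton

/-- Theorem: characterization of `c`-singletons.
`w` is a `c`-singleton (i.e. `w` is `c`-sortable and `w w₀` is `c⁻¹`-sortable) if and only if
`w` is a prefix, up to commutations, of the `c`-sorting word of `w₀`. -/
theorem statement2 [Finite W] (cs : CoxeterSystem M W)
    (c : List B) (hnd : c.Nodup) (hall : ∀ b : B, b ∈ c)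
    (w₀ : W) (hw₀ : ∀ u : W, cs.length u ≤ cs.length w₀)
    (w : W) :
    IsCSingleton cs c w₀ w ↔ IsPrefixUpToComm cs (sortingWord cs c w₀) w := by
  classical
  let : Fintype B := ⟨c.toFinset, fun b => List.mem_toFinset.2 (hall b)⟩
  constructor
  · intro h
    obtain ⟨u, z, h1, h2⟩ := h.exists_commEquiv hw₀ ⟨hnd, hall⟩
    exact ⟨u ++ z, u, h1, ⟨z, rfl⟩, h2⟩
  · rintro ⟨_, u, h, ⟨z, rfl⟩, rfl⟩
    exact isCSingleton_of_commEquiv hw₀ ⟨hnd, hall⟩ h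

end CambrianPaper

end
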